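/- Let G be a connected finite simple graph, k ≥ 2 an integer, and S ⊆ V(G). Then either G contains a tree with at most k leaves covering S, or there exists a tree T in G with at most k leaves such that α_G(S − V(T)) ≤ α_G(S) − κ_G(S) − k + 1. -/

import Mathlib

open SimpleGraph Set

variable {V : Type*}

/-- The independence number of `S` in `G`: the maximum cardinality of a subset of `S`
that is independent in `G`. -/
noncomputable def indepNumOn (G : SimpleGraph V) (S : Set V) : ℕ :=
  sSup {n | ∃ I : Set V, I ⊆ S ∧ I.Pairwise (fun a b => ¬ G.Adj a b) ∧ I.ncard = n}

/-- `I` is a maximum independent subset of `S` in `G`. -/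
def MaxIndepOn (G : SimpleGraph V) (S : Set V) (I : Set V) : Prop :=
  I ⊆ S ∧ I.Pairwise (fun a b => ¬ G.Adj a b) ∧ I.ncard = indepNumOn G S

/-- Two `x`–`y` walks are internally disjoint if they share only `x` and `y`. -/
def InternallyDisjoint (G : SimpleGraph V) {x y : V} (p q : G.Walk x y) : Prop :=
  ∀ v, v ∈ p.support → v ∈ q.support → v = x ∨ v = y

/-- Local connectivity `κ_G(x,y)`: maximum number of pairwise internally disjoint
`x`–`y` paths in `G`. -/
noncomputable def localConn (G : SimpleGraph V) (x y : V) : ℕ :=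
  sSup {n | ∃ P : Set (G.Path x y),
    P.Pairwise (fun p q => InternallyDisjoint G p.1 q.1) ∧ P.ncard = n}

/-- `κ_G(S)`: the minimum of local connectivities over distinct pairs in `S`,
`+∞` if `S` has at most one element. -/
noncomputable def setConn (G : SimpleGraph V) (S : Set V) : ℕ∞ :=
  ⨅ x ∈ S, ⨅ y ∈ S, ⨅ _ : x ≠ y, (localConn G x y : ℕ∞)

/-- Vertex connectivity `κ(G)`: the maximum `k` such that `G` has more than `k`
vertices and removing fewer than `k` vertices always leaves a connected graph. -/
noncomputable def vertexConn (G : SimpleGraph V) [Fintype V] : ℕ :=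
  sSup {k | k < Fintype.card V ∧ ∀ X : Finset V, X.card < k →
    (G.induce ((↑X : Set V)ᶜ)).Connected}

/-- The set of leaves (vertices of degree one) of a subgraph. -/
def subLeaves {G : SimpleGraph V} (T : G.Subgraph) : Set V :=
  {v | v ∈ T.verts ∧ (T.neighborSet v).ncard = 1}

/-- The set of branch vertices (vertices of degree at least three) of a subgraph. -/
def subBranches {G : SimpleGraph V} (T : G.Subgraph) : Set V :=
  {v | v ∈ T.verts ∧ 3 ≤ (T.neighborSet v).ncard}

namespace SimpleGraph

/-- There is a path from `u` to `w` in `G` whose vertex set is `F`. -/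
inductive PathOn (G : SimpleGraph V) : V → V → Set V → Prop
  | single (u : V) : PathOn G u u {u}
  | cons {u v w : V} {F : Set V} (h : G.Adj u v) (hu : u ∉ F) (p : PathOn G v w F) :
      PathOn G u w (insert u F)

namespace PathOn

variable {G H : SimpleGraph V} {u v w x y : V} {F F' : Set V}

theorem start_mem (p : PathOn G u v F) : u ∈ F := by
  cases p <;> simp

theorem end_mem (p : PathOn G u v F) : v ∈ F := by
  induction p with
  | single u => simp
  | cons h hu p ih => exact mem_insert_of_mem _ ih

theorem mono_on (p : PathOn G u v F) (h : ∀ a ∈ F, ∀ b ∈ F, G.Adj a b → H.Adj a b) :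
    PathOn H u v F := by
  induction p with
  | single u => exact single u
  | cons hadj hu p ih =>
    exact cons (h _ (mem_insert _ _) _ (mem_insert_of_mem _ p.start_mem) hadj) hu
      (ih fun a ha b hb => h a (mem_insert_of_mem _ ha) b (mem_insert_of_mem _ hb))

theorem mono (h : G ≤ H) (p : PathOn G u v F) : PathOn H u v F :=
  p.mono_on fun _ _ _ _ hab => h hab

theorem of_adj (h : G.Adj u v) : PathOn G u v {u, v} :=
  cons h (by simpa using h.ne) (single v)

theorem append_edge (p : PathOn G u v F) (h : G.Adj v x) (q : PathOn G x w F')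
    (hd : Disjoint F F') : PathOn G u w (F ∪ F') := by
  induction p with
  | single u =>
    rw [singleton_union]
    exact cons h (disjoint_singleton_left.1 hd) q
  | @cons u a b F₁ hadj hu p ih =>
    rw [insert_union]
    rw [disjoint_insert_left] at hd
    exact cons hadj (by simp [hu, hd.1]) (ih h hd.2)

theorem glue (p : PathOn G u v F) (q : PathOn G v w F') (hd : F ∩ F' ⊆ {v}) :
    PathOn G u w (F ∪ F') := by
  induction p with
  | single u =>
    rwa [singleton_union, insert_eq_of_mem q.start_mem]
  | @cons u a b F₁ hadj hu p ih =>
    rw [insert_union]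
    have hsub : F₁ ∩ F' ⊆ {b} := fun z hz => hd ⟨mem_insert_of_mem _ hz.1, hz.2⟩
    refine cons hadj ?_ (ih q hsub)
    rintro (h | h)
    · exact hu h
    · have : u = b := hd ⟨mem_insert _ _, h⟩
      exact hu (this ▸ p.end_mem)

theorem symm (p : PathOn G u v F) : PathOn G v u F := by
  induction p with
  | single u => exact single u
  | @cons u a b F₁ hadj hu p ih =>
    rw [← union_singleton]
    exact ih.append_edge hadj.symm (single u) (disjoint_singleton_right.2 hu)

theorem split (p : PathOn G u w F) (hy : y ∈ F) :
    ∃ F₁ F₂, PathOn G u y F₁ ∧ PathOn G y w F₂ ∧ F₁ ∪ F₂ = F ∧ F₁ ∩ F₂ = {y} := by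
  induction p with
  | single u =>
    obtain rfl : y = u := hy
    exact ⟨{y}, {y}, single y, single y, union_self _, inter_self _⟩
  | @cons u a b F₀ hadj hu p ih =>
    by_cases h : y = u
    · subst h
      refine ⟨{y}, insert y F₀, single y, cons hadj hu p, by simp, by simp⟩
    · obtain ⟨F₁, F₂, p₁, p₂, hU, hI⟩ := ih (mem_of_mem_insert_of_ne hy h)
      have hu1 : u ∉ F₁ := fun h' => hu (hU ▸ Or.inl h')
      have hu2 : u ∉ F₂ := fun h' => hu (hU ▸ Or.inr h')
      exact ⟨insert u F₁, F₂, cons hadj hu1 p₁, p₂, by rw [insert_union, hU],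
        by rw [insert_inter_of_notMem hu2, hI]⟩

theorem uncons (p : PathOn G u w F) (hne : u ≠ w) :
    ∃ v, G.Adj u v ∧ PathOn G v w (F \ {u}) := by
  cases p with
  | single => exact absurd rfl hne
  | @cons _ v _ F₀ h hu p => exact ⟨v, h, by simpa [hu] using p⟩

theorem exists_trans (p : PathOn G u v F) (q : PathOn G v w F') :
    ∃ F₀ ⊆ F ∪ F', PathOn G u w F₀ := by
  induction p with
  | single u => exact ⟨F', subset_union_right, q⟩
  | @cons u a b F₁ hadj hu p ih =>
    obtain ⟨F₀, hF₀, r⟩ := ih q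
    have hsub : F₀ ⊆ insert u F₁ ∪ F' :=
      hF₀.trans (union_subset_union_left _ (subset_insert _ _))
    by_cases h : u ∈ F₀
    · obtain ⟨A, B, -, r₂, hU, -⟩ := r.split h
      exact ⟨B, (subset_union_right.trans hU.subset).trans hsub, r₂⟩
    · refine ⟨insert u F₀, ?_, cons hadj h r⟩
      exact insert_subset (Or.inl (mem_insert _ _)) hsub

theorem exists_first_hit {U : Set V} (p : PathOn G u w F) (hw : w ∈ U) :
    ∃ y, ∃ F₀ ⊆ F, PathOn G u y F₀ ∧ F₀ ∩ U = {y} := by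
  induction p with
  | single u => exact ⟨u, {u}, Subset.rfl, single u, by simpa using hw⟩
  | @cons u a b F₁ hadj hu p ih =>
    by_cases h : u ∈ U
    · exact ⟨u, {u}, by simp, single u, by simpa using h⟩
    · obtain ⟨y, F₀, hF₀, q, hI⟩ := ih hw
      exact ⟨y, insert u F₀, insert_subset_insert hF₀, cons hadj (fun h' => hu (hF₀ h')) q,
        by rw [insert_inter_of_notMem h, hI]⟩

theorem of_isPath : ∀ {u v : V} (p : G.Walk u v), p.IsPath → PathOn G u v {z | z ∈ p.support}
  | _, _, .nil, _ => by simpa using single _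
  | _, _, .cons h p, hp => by
    rw [Walk.cons_isPath_iff] at hp
    have := cons h (F := {z | z ∈ p.support}) hp.2 (of_isPath p hp.1)
    convert this using 1
    ext z
    simp

theorem exists_of_reachable (h : G.Reachable u v) : ∃ F, PathOn G u v F := by
  obtain ⟨p, hp⟩ := h.exists_isPath
  exact ⟨_, of_isPath p hp⟩

theorem split_edge (p : PathOn G u w F) (h : ¬ PathOn (G.deleteEdges {s(x, y)}) u w F) :
    ∃ F₁ F₂, F₁ ∪ F₂ = F ∧
      ((PathOn (G.deleteEdges {s(x, y)}) u x F₁ ∧ PathOn (G.deleteEdges {s(x, y)}) y w F₂) ∨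
      (PathOn (G.deleteEdges {s(x, y)}) u y F₁ ∧ PathOn (G.deleteEdges {s(x, y)}) x w F₂)) := by
  induction p with
  | single u => exact absurd (single u) h
  | @cons u a b F₀ hadj hu p ih =>
    by_cases he : s(u, a) = s(x, y)
    · have hp : PathOn (G.deleteEdges {s(x, y)}) a b F₀ := by
        refine p.mono_on fun c hc d hd hcd => ?_
        rw [deleteEdges_adj, ← he]
        refine ⟨hcd, fun hmem => ?_⟩
        rcases Sym2.eq_iff.1 hmem with ⟨rfl, -⟩ | ⟨-, rfl⟩
        · exact hu hc
        · exact hu hd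
      refine ⟨{u}, F₀, singleton_union, ?_⟩
      rcases Sym2.eq_iff.1 he with ⟨rfl, rfl⟩ | ⟨rfl, rfl⟩
      · exact Or.inl ⟨single _, hp⟩
      · exact Or.inr ⟨single _, hp⟩
    · have hadj' : (G.deleteEdges {s(x, y)}).Adj u a := by
        rw [deleteEdges_adj]; exact ⟨hadj, he⟩
      have h' : ¬ PathOn (G.deleteEdges {s(x, y)}) a b F₀ := fun q => h (cons hadj' hu q)
      obtain ⟨F₁, F₂, hU, hor⟩ := ih h'
      have hu1 : u ∉ F₁ := fun h' => hu (hU ▸ Or.inl h')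
      refine ⟨insert u F₁, F₂, by rw [insert_union, hU], ?_⟩
      exact hor.imp (fun q => ⟨cons hadj' hu1 q.1, q.2⟩) (fun q => ⟨cons hadj' hu1 q.1, q.2⟩)

end PathOn

/-- There are `k` pairwise disjoint paths in `G` from `A` to `B`. -/
def HasLinkage (G : SimpleGraph V) (A B : Set V) (k : ℕ) : Prop :=
  ∃ (a b : Fin k → V) (F : Fin k → Set V), (∀ i, a i ∈ A) ∧ (∀ i, b i ∈ B) ∧
    (∀ i, PathOn G (a i) (b i) (F i)) ∧ ∀ i j, i ≠ j → Disjoint (F i) (F j)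

/-- Every path in `G` from `A` to `B` meets `X`. -/
def Separates (G : SimpleGraph V) (A B X : Set V) : Prop :=
  ∀ a ∈ A, ∀ b ∈ B, ∀ F, PathOn G a b F → (F ∩ X).Nonempty

theorem range_eq_of_injective_of_ncard_le [Finite V] {k : ℕ} {X : Set V} {f : Fin k → V}
    (hf : Function.Injective f) (hX : ∀ i, f i ∈ X) (hk : X.ncard ≤ k) : Set.range f = X := by
  refine Set.eq_of_subset_of_ncard_le (Set.range_subset_iff.2 hX) ?_ (Set.toFinite _)
  rw [← Set.image_univ, Set.ncard_image_of_injective _ hf, Set.ncard_univ, Nat.card_fin]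
  exact hk

theorem separates_of_separates_deleteEdges {G : SimpleGraph V} {A B S Y : Set V} {x y : V}
    (hS : Separates (G.deleteEdges {s(x, y)}) A B S)
    (hAy : ∀ a ∈ A, ∀ F, PathOn (G.deleteEdges {s(x, y)}) a y F → (F ∩ S).Nonempty)
    (hY : Separates (G.deleteEdges {s(x, y)}) A (insert x S) Y) : Separates G A B Y := by
  intro a ha b hb F hF
  have key : ∀ z F₁, PathOn (G.deleteEdges {s(x, y)}) a z F₁ → (F₁ ∩ S).Nonempty →
      (F₁ ∩ Y).Nonempty := by
    rintro z F₁ hF₁ ⟨s, hs, hsS⟩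
    obtain ⟨F₂, F₃, p, -, hU, -⟩ := hF₁.split hs
    obtain ⟨t, ht, htY⟩ := hY a ha s (mem_insert_of_mem _ hsS) F₂ p
    exact ⟨t, hU ▸ Or.inl ht, htY⟩
  by_cases h : PathOn (G.deleteEdges {s(x, y)}) a b F
  · exact key b F h (hS a ha b hb F h)
  · obtain ⟨F₁, F₂, hU, ⟨p, -⟩ | ⟨p, -⟩⟩ := hF.split_edge h
    · obtain ⟨t, ht, htY⟩ := hY a ha x (mem_insert _ _) F₁ p
      exact ⟨t, hU ▸ Or.inl ht, htY⟩
    · obtain ⟨t, ht, htY⟩ := key y F₁ p (hAy a ha F₁ p)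
      exact ⟨t, hU ▸ Or.inl ht, htY⟩

theorem Separates.symm {G : SimpleGraph V} {A B X : Set V} (h : Separates G A B X) :
    Separates G B A X :=
  fun b hb a ha F p => h a ha b hb F p.symm

/-- Two linkages in a subgraph in which `S` separates `A` from `B` can be joined along `S` and
an additional edge `xy`. -/
theorem HasLinkage.join [Finite V] {G H : SimpleGraph V} {A B S : Set V} {x y : V} {k : ℕ}
    (hHG : H ≤ G) (hxy : G.Adj x y) (hS : Separates H A B S) (hcard : S.ncard < k)
    (hx : x ∉ S) (hy : y ∉ S) (h₁ : HasLinkage H A (insert x S) k)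
    (h₂ : HasLinkage H (insert y S) B k) : HasLinkage G A B k := by
  classical
  obtain ⟨a, b, F, ha, hb, hF, hdF⟩ := h₁
  obtain ⟨c, d, E, hc, hd, hE, hdE⟩ := h₂
  have hbinj : Function.Injective b := by
    intro i j hij
    by_contra hne
    exact Set.disjoint_left.1 (hdF i j hne) (hF i).end_mem (hij ▸ (hF j).end_mem)
  have hcinj : Function.Injective c := by
    intro i j hij
    by_contra hne
    exact Set.disjoint_left.1 (hdE i j hne) (hE i).start_mem (hij ▸ (hE j).start_mem)
  have hbr : Set.range b = insert x S :=
    range_eq_of_injective_of_ncard_le hbinj hb ((Set.ncard_insert_le _ _).trans hcard)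
  have hcr : Set.range c = insert y S :=
    range_eq_of_injective_of_ncard_le hcinj hc ((Set.ncard_insert_le _ _).trans hcard)
  have hFS : ∀ i, ∀ s ∈ F i, s ∈ S → s = b i := by
    intro i s hs hsS
    obtain ⟨j, rfl⟩ : s ∈ Set.range b := hbr ▸ mem_insert_of_mem _ hsS
    by_contra hne
    have hij : i ≠ j := fun h => hne (h ▸ rfl)
    exact Set.disjoint_left.1 (hdF i j hij) hs (hF j).end_mem
  have hES : ∀ i, ∀ s ∈ E i, s ∈ S → s = c i := by
    intro i s hs hsS
    obtain ⟨j, rfl⟩ : s ∈ Set.range c := hcr ▸ mem_insert_of_mem _ hsS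
    by_contra hne
    have hij : i ≠ j := fun h => hne (h ▸ rfl)
    exact Set.disjoint_left.1 (hdE i j hij) hs (hE j).start_mem
  have hmeet : ∀ i j v, v ∈ F i → v ∈ E j → v ∈ S ∧ v = b i ∧ v = c j := by
    intro i j v hvF hvE
    obtain ⟨F₁, F₂, p₁, p₂, hFU, hFI⟩ := (hF i).split hvF
    obtain ⟨E₁, E₂, q₁, q₂, hEU, hEI⟩ := (hE j).split hvE
    obtain ⟨W, hW, r⟩ := p₁.exists_trans q₂
    obtain ⟨s, hsW, hsS⟩ := hS _ (ha i) _ (hd j) W r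
    have hvs : v = s := by
      rcases hW hsW with hs | hs
      · have : s = b i := hFS i s (hFU ▸ Or.inl hs) hsS
        have h' : s ∈ F₁ ∩ F₂ := ⟨hs, this ▸ p₂.end_mem⟩
        rw [hFI] at h'
        exact h'.symm
      · have : s = c j := hES j s (hEU ▸ Or.inr hs) hsS
        have h' : s ∈ E₁ ∩ E₂ := ⟨this ▸ q₁.start_mem, hs⟩
        rw [hEI] at h'
        exact h'.symm
    subst hvs
    exact ⟨hsS, hFS i v hvF hsS, hES j v hvE hsS⟩
  have hnext : ∀ i, ∃ j, (b i = x ∧ c j = y) ∨ (b i ∈ S ∧ c j = b i) := by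
    intro i
    rcases hb i with h | h
    · obtain ⟨j, hj⟩ : y ∈ Set.range c := hcr ▸ mem_insert _ _
      exact ⟨j, Or.inl ⟨h, hj⟩⟩
    · obtain ⟨j, hj⟩ : b i ∈ Set.range c := hcr ▸ mem_insert_of_mem _ h
      exact ⟨j, Or.inr ⟨h, hj⟩⟩
  choose j hj using hnext
  have hjinj : ∀ i i', i ≠ i' → j i ≠ j i' := by
    intro i i' hne heq
    apply hne
    apply hbinj
    rcases hj i with ⟨h1, h2⟩ | ⟨h1, h2⟩ <;> rcases hj i' with ⟨h3, h4⟩ | ⟨h3, h4⟩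
    · rw [h1, h3]
    · rw [← heq, h2] at h4
      exact absurd (h4 ▸ h3) hy
    · rw [heq, h4] at h2
      exact absurd (h2 ▸ h1) hy
    · rw [← h2, ← h4, heq]
  have hcross : ∀ i i', i ≠ i' → Disjoint (F i) (E (j i')) := by
    intro i i' hne
    rw [Set.disjoint_left]
    intro v hv hv'
    obtain ⟨hvS, hvb, hvc⟩ := hmeet _ _ v hv hv'
    rcases hj i' with ⟨-, h2⟩ | ⟨-, h2⟩
    · rw [h2] at hvc
      exact hy (hvc ▸ hvS)
    · exact hne (hbinj (by rw [← hvb, hvc, h2]))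
  refine ⟨a, fun i => d (j i), fun i => F i ∪ E (j i), ha, fun i => hd _, fun i => ?_, ?_⟩
  · have p := (hF i).mono hHG
    have q := (hE (j i)).mono hHG
    rcases hj i with ⟨h1, h2⟩ | ⟨h1, h2⟩
    · refine p.append_edge (by rw [h1, h2]; exact hxy) q ?_
      rw [Set.disjoint_left]
      intro v hv hv'
      obtain ⟨hvS, hvb, -⟩ := hmeet _ _ v hv hv'
      exact hx (h1 ▸ hvb ▸ hvS)
    · rw [h2] at q
      exact p.glue q fun v hv => (hmeet _ _ v hv.1 hv.2).2.1
  · intro i i' hne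
    rw [Set.disjoint_union_left, Set.disjoint_union_right, Set.disjoint_union_right]
    exact ⟨⟨hdF _ _ hne, hcross _ _ hne⟩, (hcross _ _ hne.symm).symm, hdE _ _ (hjinj _ _ hne)⟩

/-- **Menger's theorem**: if no set of fewer than `k` vertices separates `A` from `B`, then there
are `k` disjoint paths from `A` to `B`. -/
theorem hasLinkage_of_forall_separates [Finite V] (G : SimpleGraph V) (A B : Set V) (k : ℕ)
    (h : ∀ X, Separates G A B X → k ≤ X.ncard) : HasLinkage G A B k := by
  classical
  induction G using WellFoundedLT.induction generalizing A B with
  | ind G ih =>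
  by_cases hG : ∃ x y, G.Adj x y
  · obtain ⟨x, y, hxy⟩ := hG
    have hlt : G.deleteEdges {s(x, y)} < G := by
      refine lt_of_le_of_ne (G.deleteEdges_le _) fun heq => ?_
      rw [← heq, deleteEdges_adj] at hxy
      exact hxy.2 rfl
    by_cases hS : ∃ S, Separates (G.deleteEdges {s(x, y)}) A B S ∧ S.ncard < k
    · obtain ⟨S, hS, hSk⟩ := hS
      have hnS : ¬ Separates G A B S := fun h' => absurd (h S h') (by omega)
      simp only [Separates, not_forall] at hnS
      obtain ⟨a, ha, b, hb, F, hF, hFS⟩ := hnS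
      have hnF : ¬ PathOn (G.deleteEdges {s(x, y)}) a b F := fun h' => hFS (hS a ha b hb F h')
      obtain ⟨F₁, F₂, hU, hor⟩ := hF.split_edge hnF
      have hF₁ : ∀ v ∈ F₁, v ∉ S := fun v hv hvS => hFS ⟨v, hU ▸ Or.inl hv, hvS⟩
      have hF₂ : ∀ v ∈ F₂, v ∉ S := fun v hv hvS => hFS ⟨v, hU ▸ Or.inr hv, hvS⟩
      have main : ∀ x' y', s(x', y') = s(x, y) →
          PathOn (G.deleteEdges {s(x, y)}) a x' F₁ → PathOn (G.deleteEdges {s(x, y)}) y' b F₂ →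
          HasLinkage G A B k := by
        intro x' y' he p q
        have hadj : G.Adj x' y' := by
          rw [← mem_edgeSet, he, mem_edgeSet]; exact hxy
        have he' : s(y', x') = s(x, y) := Sym2.eq_swap.trans he
        have h₁ : ∀ c ∈ A, ∀ E, PathOn (G.deleteEdges {s(x', y')}) c y' E → (E ∩ S).Nonempty := by
          intro c hc E r
          rw [he] at r
          obtain ⟨W, hW, r'⟩ := r.exists_trans q
          obtain ⟨s, hs, hsS⟩ := hS c hc b hb W r'
          exact ⟨s, (hW hs).resolve_right fun h' => hF₂ s h' hsS, hsS⟩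
        have h₂ : ∀ c ∈ B, ∀ E, PathOn (G.deleteEdges {s(y', x')}) c x' E → (E ∩ S).Nonempty := by
          intro c hc E r
          rw [he'] at r
          obtain ⟨W, hW, r'⟩ := p.exists_trans r.symm
          obtain ⟨s, hs, hsS⟩ := hS a ha c hc W r'
          exact ⟨s, (hW hs).resolve_left fun h' => hF₁ s h' hsS, hsS⟩
        refine HasLinkage.join hlt.le hadj hS hSk (hF₁ _ p.end_mem) (hF₂ _ q.start_mem)
          (ih _ hlt _ _ fun Y hY => h Y ?_) (ih _ hlt _ _ fun Y hY => h Y ?_)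
        · rw [← he] at hY hS
          exact separates_of_separates_deleteEdges hS h₁ hY
        · rw [← he'] at hY hS
          exact (separates_of_separates_deleteEdges hS.symm h₂ hY.symm).symm
      rcases hor with ⟨p, q⟩ | ⟨p, q⟩
      · exact main x y rfl p q
      · exact main y x Sym2.eq_swap p q
    · simp only [not_exists, not_and, not_lt] at hS
      obtain ⟨a, b, F, ha, hb, hF, hd⟩ := ih _ hlt A B hS
      exact ⟨a, b, F, ha, hb, fun i => (hF i).mono hlt.le, hd⟩
  · have hsep : Separates G A B (A ∩ B) := by
      intro a ha b hb F p
      cases p with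
      | single => exact ⟨a, rfl, ha, hb⟩
      | cons hadj => exact absurd ⟨_, _, hadj⟩ hG
    have hk := h _ hsep
    have : Fintype ↥(A ∩ B) := Fintype.ofFinite _
    rw [← Nat.card_coe_set_eq, Nat.card_eq_fintype_card, ← Fintype.card_fin k] at hk
    obtain ⟨f⟩ := Function.Embedding.nonempty_of_card_le hk
    refine ⟨fun i => f i, fun i => f i, fun i => {(f i : V)}, fun i => (f i).2.1,
      fun i => (f i).2.2, fun i => .single _, fun i j hij => ?_⟩
    rw [Set.disjoint_singleton]
    exact fun h' => hij (f.injective (Subtype.ext h'))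

end SimpleGraph

section IndepNumOn

/-- `G` has a path from `z` to `z'` all of whose inner vertices lie in `A`. -/
def LinkedVia (G : SimpleGraph V) (A : Set V) (z z' : V) : Prop :=
  ∃ F, PathOn G z z' F ∧ F ⊆ A ∪ {z, z'}

theorem LinkedVia.symm {G : SimpleGraph V} {A : Set V} {z z' : V} (h : LinkedVia G A z z') :
    LinkedVia G A z' z := by
  obtain ⟨F, p, hF⟩ := h
  exact ⟨F, p.symm, by rwa [pair_comm]⟩

variable [Finite V] {G : SimpleGraph V} {D D' I X Y A Z Z' : Set V} {x : V}

theorem bddAbove_indepNumOn (G : SimpleGraph V) (D : Set V) :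
    BddAbove {n | ∃ I : Set V, I ⊆ D ∧ I.Pairwise (fun a b => ¬ G.Adj a b) ∧ I.ncard = n} := by
  refine ⟨Nat.card V, ?_⟩
  rintro n ⟨I, -, -, rfl⟩
  exact Set.ncard_le_card I

theorem ncard_le_indepNumOn (hI : I ⊆ D) (hind : I.Pairwise fun a b => ¬ G.Adj a b) :
    I.ncard ≤ indepNumOn G D :=
  le_csSup (bddAbove_indepNumOn G D) ⟨I, hI, hind, rfl⟩

theorem exists_maxIndepOn (G : SimpleGraph V) (D : Set V) : ∃ I, MaxIndepOn G D I := by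
  have := Nat.sSup_mem (s := {n | ∃ I : Set V, I ⊆ D ∧ I.Pairwise (fun a b => ¬ G.Adj a b) ∧
    I.ncard = n}) ⟨0, ∅, empty_subset _, Set.pairwise_empty _, Set.ncard_empty _⟩
    (bddAbove_indepNumOn G D)
  exact this

theorem indepNumOn_mono (h : D ⊆ D') : indepNumOn G D ≤ indepNumOn G D' := by
  obtain ⟨I, hI, hind, hcard⟩ := exists_maxIndepOn G D
  rw [← hcard]
  exact ncard_le_indepNumOn (hI.trans h) hind

theorem indepNumOn_union_le (G : SimpleGraph V) (X Y : Set V) :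
    indepNumOn G (X ∪ Y) ≤ indepNumOn G X + indepNumOn G Y := by
  obtain ⟨I, hI, hind, hcard⟩ := exists_maxIndepOn G (X ∪ Y)
  rw [← hcard]
  calc I.ncard = ((I ∩ X) ∪ (I ∩ Y)).ncard := by
        rw [← inter_union_distrib_left, inter_eq_left.2 hI]
    _ ≤ (I ∩ X).ncard + (I ∩ Y).ncard := Set.ncard_union_le _ _
    _ ≤ _ := add_le_add
        (ncard_le_indepNumOn inter_subset_right (hind.mono inter_subset_left))
        (ncard_le_indepNumOn inter_subset_right (hind.mono inter_subset_left))

theorem indepNumOn_union (hd : Disjoint X Y) (hadj : ∀ a ∈ X, ∀ b ∈ Y, ¬ G.Adj a b) :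
    indepNumOn G (X ∪ Y) = indepNumOn G X + indepNumOn G Y := by
  refine le_antisymm (indepNumOn_union_le G X Y) ?_
  obtain ⟨I, hI, hind, hcard⟩ := exists_maxIndepOn G X
  obtain ⟨J, hJ, hind', hcard'⟩ := exists_maxIndepOn G Y
  rw [← hcard, ← hcard', ← Set.ncard_union_eq (hd.mono hI hJ)]
  refine ncard_le_indepNumOn (union_subset_union hI hJ) ?_
  rw [Set.pairwise_union]
  exact ⟨hind, hind', fun a ha b hb _ =>
    ⟨hadj a (hI ha) b (hJ hb), fun h => hadj a (hI ha) b (hJ hb) h.symm⟩⟩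

theorem indepNumOn_singleton (G : SimpleGraph V) (x : V) : indepNumOn G {x} = 1 := by
  refine le_antisymm ?_ ?_
  · obtain ⟨I, hI, -, hcard⟩ := exists_maxIndepOn G {x}
    rw [← hcard, ← Set.ncard_singleton x]
    exact Set.ncard_le_ncard hI
  · rw [← Set.ncard_singleton x]
    exact ncard_le_indepNumOn Subset.rfl (Set.pairwise_singleton _ _)

theorem indepNumOn_insert_le (G : SimpleGraph V) (x : V) (D : Set V) :
    indepNumOn G (insert x D) ≤ indepNumOn G D + 1 := by
  rw [← union_singleton, ← indepNumOn_singleton G x]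
  exact indepNumOn_union_le _ _ _

theorem indepNumOn_empty (G : SimpleGraph V) : indepNumOn G ∅ = 0 := by
  obtain ⟨I, hI, -, hcard⟩ := exists_maxIndepOn G ∅
  rw [← hcard, subset_empty_iff.1 hI, Set.ncard_empty]

theorem indepNumOn_pos (h : D.Nonempty) : 0 < indepNumOn G D := by
  obtain ⟨x, hx⟩ := h
  calc 0 < indepNumOn G {x} := by rw [indepNumOn_singleton]; exact one_pos
    _ ≤ _ := indepNumOn_mono (singleton_subset_iff.2 hx)

/-- If no path through `A` links `Z` to `Z'`, then the contributions of `Z` and `Z'` to the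
independence number over `A` are additive. -/
theorem indepNumOn_union_add (h : ∀ z ∈ Z, ∀ z' ∈ Z', ¬ LinkedVia G A z z')
    (hZ : Disjoint Z A) (hZ' : Disjoint Z' A) :
    indepNumOn G (A ∪ (Z ∪ Z')) + indepNumOn G A =
      indepNumOn G (A ∪ Z) + indepNumOn G (A ∪ Z') := by
  let K : Set V := {a | a ∈ A ∧ ∃ z ∈ Z, ∃ F, PathOn G z a F ∧ F ⊆ A ∪ {z}}
  have hKA : K ⊆ A := fun a ha => ha.1
  have hA : A = K ∪ (A \ K) := (union_sdiff_cancel hKA).symm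
  have hZZ' : Disjoint Z Z' := Set.disjoint_left.2 fun z hz hz' =>
    h z hz z hz' ⟨{z}, .single z, by simp⟩
  have hZZ'adj : ∀ a ∈ Z, ∀ b ∈ Z', ¬ G.Adj a b := fun a ha b hb hab =>
    h a ha b hb ⟨{a, b}, .of_adj hab, subset_union_right⟩
  have hZA : ∀ a ∈ Z, ∀ b ∈ A \ K, ¬ G.Adj a b := fun a ha b hb hab =>
    hb.2 ⟨hb.1, a, ha, {a, b}, .of_adj hab, by
      rintro v (rfl | rfl)
      · exact Or.inr rfl
      · exact Or.inl hb.1⟩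
  have hKA' : ∀ a ∈ K, ∀ b ∈ A \ K, ¬ G.Adj a b := by
    rintro a ⟨-, z, hz, F, p, hF⟩ b hb hab
    obtain ⟨F₀, hF₀, q⟩ := p.exists_trans (.of_adj hab)
    refine hb.2 ⟨hb.1, z, hz, F₀, q, fun v hv => ?_⟩
    rcases hF₀ hv with hv | rfl | rfl
    · exact hF hv
    · exact hF p.end_mem
    · exact Or.inl hb.1
  have hKZ' : ∀ a ∈ K, ∀ b ∈ Z', ¬ G.Adj a b := by
    rintro a ⟨-, z, hz, F, p, hF⟩ b hb hab
    obtain ⟨F₀, hF₀, q⟩ := p.exists_trans (.of_adj hab)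
    refine h z hz b hb ⟨F₀, q, fun v hv => ?_⟩
    have hF' : F ⊆ A ∪ {z, b} := hF.trans (union_subset_union_right _ (by simp))
    rcases hF₀ hv with hv | rfl | rfl
    · exact hF' hv
    · exact hF' p.end_mem
    · exact Or.inr (Or.inr rfl)
  have hZK : Disjoint Z K := hZ.mono_right hKA
  have hZ'K : Disjoint Z' K := hZ'.mono_right hKA
  have hKd : Disjoint K (A \ K) := disjoint_sdiff_right
  have hZd : Disjoint Z (A \ K) := hZ.mono_right sdiff_subset
  have hZ'd : Disjoint Z' (A \ K) := hZ'.mono_right sdiff_subset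
  have e1 : indepNumOn G (A ∪ (Z ∪ Z')) =
      indepNumOn G (Z ∪ K) + indepNumOn G (Z' ∪ (A \ K)) := by
    rw [← indepNumOn_union]
    · congr 1
      nth_rewrite 1 [hA]
      ac_rfl
    · simp only [Set.disjoint_union_left, Set.disjoint_union_right]
      exact ⟨⟨hZZ', hZ'K.symm⟩, hZd, hKd⟩
    · rintro a (ha | ha) b (hb | hb)
      exacts [hZZ'adj a ha b hb, hZA a ha b hb, hKZ' a ha b hb, hKA' a ha b hb]
  have e2 : indepNumOn G A = indepNumOn G K + indepNumOn G (A \ K) := by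
    rw [← indepNumOn_union hKd hKA', ← hA]
  have e3 : indepNumOn G (A ∪ Z) = indepNumOn G (Z ∪ K) + indepNumOn G (A \ K) := by
    rw [← indepNumOn_union]
    · congr 1
      nth_rewrite 1 [hA]
      ac_rfl
    · rw [Set.disjoint_union_left]
      exact ⟨hZd, hKd⟩
    · rintro a (ha | ha) b hb
      exacts [hZA a ha b hb, hKA' a ha b hb]
  have e4 : indepNumOn G (A ∪ Z') = indepNumOn G K + indepNumOn G (Z' ∪ (A \ K)) := by
    rw [← indepNumOn_union]
    · congr 1
      nth_rewrite 1 [hA]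
      ac_rfl
    · rw [Set.disjoint_union_right]
      exact ⟨hZ'K.symm, hKd⟩
    · rintro a ha b (hb | hb)
      exacts [hKZ' a ha b hb, hKA' a ha b hb]
  omega

/-- Pairwise unlinked sets, each of which increases the independence number over `A`, together
increase it by at least their number. -/
theorem add_card_le_indepNumOn_biUnion {ι : Type*} (C : Finset ι) (Q : ι → Set V)
    (hQ : ∀ i ∈ C, indepNumOn G A < indepNumOn G (A ∪ Q i)) (hQA : ∀ i ∈ C, Disjoint (Q i) A)
    (h : ∀ i ∈ C, ∀ j ∈ C, i ≠ j → ∀ z ∈ Q i, ∀ z' ∈ Q j, ¬ LinkedVia G A z z') :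
    indepNumOn G A + C.card ≤ indepNumOn G (A ∪ ⋃ i ∈ C, Q i) := by
  classical
  induction C using Finset.induction_on with
  | empty => simp
  | insert i C hi ih =>
    have ih := ih (fun j hj => hQ j (Finset.mem_insert_of_mem hj))
      (fun j hj => hQA j (Finset.mem_insert_of_mem hj))
      (fun j hj j' hj' => h j (Finset.mem_insert_of_mem hj) j' (Finset.mem_insert_of_mem hj'))
    have hadd := indepNumOn_union_add (G := G) (A := A) (Z := Q i) (Z' := ⋃ j ∈ C, Q j)
      (fun z hz z' hz' => by
        simp only [Set.mem_iUnion] at hz'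
        obtain ⟨j, hj, hz'⟩ := hz'
        exact h i (Finset.mem_insert_self _ _) j (Finset.mem_insert_of_mem hj)
          (fun e => hi (e ▸ hj)) z hz z' hz')
      (hQA i (Finset.mem_insert_self _ _))
      (by
        simp only [Set.disjoint_iUnion_left]
        exact fun j hj => hQA j (Finset.mem_insert_of_mem hj))
    have hpos := hQ i (Finset.mem_insert_self _ _)
    rw [Finset.card_insert_of_notMem hi, Finset.set_biUnion_insert]
    omega

end IndepNumOn

namespace SimpleGraph

variable {G : SimpleGraph V}

theorem isTree_coe_of_connected_of_isAcyclic {T : G.Subgraph} (hc : T.Connected)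
    (ha : T.spanningCoe.IsAcyclic) : T.coe.IsTree :=
  ⟨hc.coe, ha.comap ⟨Subtype.val, fun h => h⟩ Subtype.val_injective⟩

theorem isAcyclic_spanningCoe_sup_subgraphOfAdj {T : G.Subgraph} {u w : V}
    (ha : T.spanningCoe.IsAcyclic) (h : G.Adj u w) (hw : w ∉ T.verts) :
    (T ⊔ G.subgraphOfAdj h).spanningCoe.IsAcyclic := by
  have hnr : ¬ T.spanningCoe.Reachable u w := by
    rintro ⟨p⟩
    have := p.reverse
    cases this with
    | nil => exact h.ne rfl
    | cons hadj _ => exact hw (T.edge_vert hadj)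
  refine (ha.sup_edge_of_not_reachable hnr).anti fun a b hab => ?_
  simp only [Subgraph.spanningCoe_adj, Subgraph.sup_adj, subgraphOfAdj_adj] at hab
  rcases hab with hab | hab
  · exact Or.inl hab
  · refine Or.inr ?_
    rw [edge_adj]
    rcases Sym2.eq_iff.1 hab with ⟨rfl, rfl⟩ | ⟨rfl, rfl⟩
    · exact ⟨Or.inl ⟨rfl, rfl⟩, h.ne⟩
    · exact ⟨Or.inr ⟨rfl, rfl⟩, h.ne'⟩

/-- A path starting in a tree `T` and otherwise disjoint from it can be attached to `T`; the end
of the path is the only vertex that may become a leaf. -/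
theorem exists_subgraph_attach [Finite V] {u w : V} {F : Set V} (p : PathOn G u w F) (E : Set V) :
    ∀ T : G.Subgraph, T.Connected → T.spanningCoe.IsAcyclic → u ∈ T.verts → F ∩ T.verts ⊆ {u} →
      subLeaves T ⊆ insert u E → (T.neighborSet u = ∅ → u ∈ E) →
      ∃ T' : G.Subgraph, T'.Connected ∧ T'.spanningCoe.IsAcyclic ∧ T'.verts = T.verts ∪ F ∧
        subLeaves T' ⊆ insert w E := by
  induction p with
  | single u =>
    intro T hc ha hu _ hl _
    exact ⟨T, hc, ha, by rw [union_singleton, insert_eq_of_mem hu], hl⟩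
  | @cons u v w F h hu p ih =>
    intro T hc ha huT hF hl hE
    have hvT : v ∉ T.verts := fun hv =>
      h.ne (hF ⟨mem_insert_of_mem _ p.start_mem, hv⟩ : v = u).symm
    have hverts : (T ⊔ G.subgraphOfAdj h).verts = insert v T.verts := by
      ext z
      simp only [Subgraph.verts_sup, subgraphOfAdj_verts, Set.mem_union, Set.mem_insert_iff,
        Set.mem_singleton_iff]
      constructor
      · rintro (hz | rfl | rfl)
        exacts [Or.inr hz, Or.inr huT, Or.inl rfl]
      · rintro (rfl | hz)
        exacts [Or.inr (Or.inr rfl), Or.inl hz]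
    have hnbr : ∀ z a, (T ⊔ G.subgraphOfAdj h).Adj z a ↔
        T.Adj z a ∨ (z = u ∧ a = v) ∨ (z = v ∧ a = u) := by
      intro z a
      rw [Subgraph.sup_adj, subgraphOfAdj_adj]
      refine or_congr_right ?_
      rw [Sym2.eq_iff]
      constructor <;> rintro (⟨rfl, rfl⟩ | ⟨rfl, rfl⟩) <;> simp
    obtain ⟨T', hc', ha', hv', hl'⟩ := ih (T ⊔ G.subgraphOfAdj h)
      (Subgraph.connected_sup hc.preconnected (Subgraph.subgraphOfAdj_connected h).preconnected
        ⟨u, huT, by simp⟩)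
      (isAcyclic_spanningCoe_sup_subgraphOfAdj ha h hvT)
      (hverts ▸ mem_insert _ _)
      (by
        rw [hverts]
        rintro z ⟨hz, rfl | hzT⟩
        · rfl
        · have : z = u := hF ⟨mem_insert_of_mem _ hz, hzT⟩
          exact absurd (this ▸ hz) hu)
      (by
        rintro z ⟨hzv, hz⟩
        rw [hverts] at hzv
        by_cases hzv' : z = v
        · exact Or.inl hzv'
        have hzT := mem_of_mem_insert_of_ne hzv hzv'
        right
        by_cases hzu : z = u
        · subst hzu
          apply hE
          have hins : (T ⊔ G.subgraphOfAdj h).neighborSet z = insert v (T.neighborSet z) := by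
            ext a
            simp only [Subgraph.mem_neighborSet, hnbr, Set.mem_insert_iff]
            have := h.ne
            tauto
          have hvn : v ∉ T.neighborSet z := fun hv => hvT (T.edge_vert hv.symm)
          rw [hins, Set.ncard_insert_of_notMem hvn] at hz
          exact (Set.ncard_eq_zero (Set.toFinite _)).1 (by omega)
        · have hsame : (T ⊔ G.subgraphOfAdj h).neighborSet z = T.neighborSet z := by
            ext a
            simp only [Subgraph.mem_neighborSet, hnbr]
            tauto
          rw [hsame] at hz
          exact mem_of_mem_insert_of_ne (hl ⟨hzT, hz⟩) hzu)
      (by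
        intro h0
        have : u ∈ (T ⊔ G.subgraphOfAdj h).neighborSet v := by
          rw [Subgraph.mem_neighborSet, hnbr]; simp
        rw [h0] at this
        exact this.elim)
    refine ⟨T', hc', ha', ?_, hl'⟩
    rw [hv', hverts]
    ext z
    simp only [Set.mem_union, Set.mem_insert_iff]
    have h1 : z = u → z ∈ T.verts := fun e => e ▸ huT
    have h2 : z = v → z ∈ F := fun e => e ▸ p.start_mem
    tauto

theorem PathOn.exists_subgraph [Finite V] {u w : V} {F : Set V} (p : PathOn G u w F) :
    ∃ T : G.Subgraph, T.Connected ∧ T.spanningCoe.IsAcyclic ∧ T.verts = F ∧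
      (subLeaves T).ncard ≤ 2 := by
  obtain ⟨T, hc, ha, hv, hl⟩ := exists_subgraph_attach p {u} (G.singletonSubgraph u)
    Subgraph.singletonSubgraph_connected (by
      refine isAcyclic_bot.anti fun a b hab => ?_
      simp at hab) (by simp) (by simp)
    (fun z hz => by
      have := hz.1
      simp at this
      simp [this]) (by simp)
  refine ⟨T, hc, ha, ?_, (Set.ncard_le_ncard hl).trans
    ((Set.ncard_insert_le _ _).trans (by rw [Set.ncard_singleton]))⟩
  rw [hv, singletonSubgraph_verts, singleton_union, insert_eq_of_mem p.start_mem]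

/-- A tree can be enlarged so that the independence number of the uncovered part of `S` drops,
at the cost of at most one more leaf. -/
theorem exists_subgraph_indepNumOn_add_one_le [Finite V] (hG : G.Connected) {S : Set V} {k : ℕ}
    (hk : 2 ≤ k) {T : G.Subgraph} (hc : T.Connected) (ha : T.spanningCoe.IsAcyclic)
    (hl : (subLeaves T).ncard ≤ k) (hS : ¬ S ⊆ T.verts) :
    ∃ T' : G.Subgraph, T'.Connected ∧ T'.spanningCoe.IsAcyclic ∧
      (subLeaves T').ncard ≤ k + 1 ∧
      indepNumOn G (S \ T'.verts) + 1 ≤ indepNumOn G (S \ T.verts) := by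
  obtain ⟨y, hyS, hyT⟩ := Set.not_subset.1 hS
  obtain ⟨t₀, ht₀⟩ := hc.nonempty
  have hex : ∃ n, ∃ t z F, PathOn G t z F ∧ F ∩ T.verts = {t} ∧ z ∈ S \ T.verts ∧
      Nat.card V - F.ncard = n := by
    obtain ⟨F, p⟩ := PathOn.exists_of_reachable (hG.preconnected y t₀)
    obtain ⟨t, F₀, -, q, hI⟩ := p.exists_first_hit ht₀
    exact ⟨_, t, y, F₀, q.symm, hI, ⟨hyS, hyT⟩, rfl⟩
  classical
  obtain ⟨t, z, F, p, hI, hz, hn⟩ := Nat.find_spec hex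
  have hmax : ∀ z' ∈ S \ T.verts, G.Adj z z' → z' ∈ F := by
    intro z' hz' hadj
    by_contra hzF
    have hI' : (F ∪ {z'}) ∩ T.verts = {t} := by
      rw [Set.union_inter_distrib_right, hI, Set.singleton_inter_eq_empty.2 hz'.2, Set.union_empty]
    have q := p.append_edge hadj (.single z') (Set.disjoint_singleton_right.2 hzF)
    have := Nat.find_min' hex ⟨t, z', _, q, hI', hz', rfl⟩
    rw [← hn, Set.union_singleton, Set.ncard_insert_of_notMem hzF] at this
    have hle := Set.ncard_le_card (insert z' F)
    rw [Set.ncard_insert_of_notMem hzF] at hle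
    omega
  have htT : t ∈ T.verts := by
    have : t ∈ F ∩ T.verts := hI ▸ rfl
    exact this.2
  have hstep : ∀ E : Set V, subLeaves T ⊆ insert t E → (T.neighborSet t = ∅ → t ∈ E) →
      E.ncard ≤ k → ∃ T' : G.Subgraph, T'.Connected ∧ T'.spanningCoe.IsAcyclic ∧
        (subLeaves T').ncard ≤ k + 1 ∧
        indepNumOn G (S \ T'.verts) + 1 ≤ indepNumOn G (S \ T.verts) := by
    intro E h1 h2 h3
    obtain ⟨T', hc', ha', hv', hl'⟩ :=
      exists_subgraph_attach p E T hc ha htT hI.subset h1 h2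
    refine ⟨T', hc', ha', ?_, ?_⟩
    · exact (Set.ncard_le_ncard hl').trans ((Set.ncard_insert_le _ _).trans (by omega))
    · have hzT' : z ∉ S \ T'.verts := fun h => h.2 (hv' ▸ Or.inr p.end_mem)
      rw [← indepNumOn_singleton G z, ← indepNumOn_union]
      · refine indepNumOn_mono (Set.union_subset ?_ (Set.singleton_subset_iff.2 hz))
        exact fun v hv => ⟨hv.1, fun h => hv.2 (hv' ▸ Or.inl h)⟩
      · exact Set.disjoint_singleton_right.2 hzT'
      · rintro a ⟨haS, haT⟩ b rfl hab
        rw [hv'] at haT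
        exact haT (Or.inr (hmax a ⟨haS, fun h => haT (Or.inl h)⟩ hab.symm))
  by_cases hiso : T.neighborSet t = ∅
  · refine hstep {t} ?_ (fun _ => rfl) (by rw [Set.ncard_singleton]; omega)
    rintro v ⟨hv, hv1⟩
    left
    by_contra hne
    have : Nontrivial T.verts := ⟨⟨v, hv⟩, ⟨t, htT⟩, fun h => hne (congrArg Subtype.val h)⟩
    obtain ⟨u, hu⟩ := hc.preconnected.exists_adj_of_nontrivial ⟨t, htT⟩
    have : u ∈ T.neighborSet t := hu
    rw [hiso] at this
    exact this
  · exact hstep (subLeaves T) (subset_insert _ _) (fun h => absurd h hiso) hl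

/-- The vertices `v 0, …, v (n - 1)` are distinct and consecutive ones are adjacent. -/
structure IsPathSeq (G : SimpleGraph V) (v : ℕ → V) (n : ℕ) : Prop where
  inj : ∀ i < n, ∀ j < n, v i = v j → i = j
  adj : ∀ i, i + 1 < n → G.Adj (v i) (v (i + 1))

theorem PathOn.exists_isPathSeq {u w : V} {F : Set V} (p : PathOn G u w F) :
    ∃ v n, IsPathSeq G v (n + 1) ∧ v 0 = u ∧ v '' Ico 0 (n + 1) = F := by
  induction p with
  | single u =>
    refine ⟨fun _ => u, 0, ⟨by omega, by omega⟩, rfl, ?_⟩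
    ext z
    simp only [Set.mem_image, Set.mem_Ico, Set.mem_singleton_iff]
    exact ⟨fun ⟨_, _, e⟩ => e.symm, fun e => ⟨0, by omega, e.symm⟩⟩
  | @cons u a w F h hu p ih =>
    obtain ⟨v, n, hv, h0, hF⟩ := ih
    have hmem : ∀ i < n + 1, v i ∈ F := fun i hi => hF ▸ ⟨i, ⟨i.zero_le, hi⟩, rfl⟩
    refine ⟨fun i => Nat.casesOn i u v, n + 1, ⟨?_, ?_⟩, rfl, ?_⟩
    · rintro (_ | i) hi (_ | j) hj hij
      · rfl
      · exact absurd (show u ∈ F from (show u = v j from hij) ▸ hmem j (by omega)) hu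
      · exact absurd (show u ∈ F from (show v i = u from hij) ▸ hmem i (by omega)) hu
      · exact congrArg _ (hv.inj i (by omega) j (by omega) hij)
    · rintro (_ | i) hi
      · exact (show G.Adj u (v 0) from h0 ▸ h)
      · exact hv.adj i (by omega)
    · ext z
      simp only [Set.mem_image, Set.mem_Ico, Set.mem_insert_iff, ← hF]
      constructor
      · rintro ⟨_ | i, hi, rfl⟩
        · exact Or.inl rfl
        · exact Or.inr ⟨i, by omega, rfl⟩
      · rintro (rfl | ⟨i, hi, rfl⟩)
        · exact ⟨0, by omega, rfl⟩
        · exact ⟨i + 1, by omega, rfl⟩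

namespace IsPathSeq

variable {v : ℕ → V} {n : ℕ}

theorem pathOn_Ico (hv : IsPathSeq G v n) (i k : ℕ) (hk : i + k < n) :
    PathOn G (v i) (v (i + k)) (v '' Ico i (i + k + 1)) := by
  induction k with
  | zero =>
    have h : Ico i (i + 0 + 1) = {i} := by
      ext z
      simp only [Set.mem_Ico, Set.mem_singleton_iff]
      omega
    rw [h, image_singleton]
    exact .single (v i)
  | succ k ih =>
    have := (ih (by omega)).append_edge (hv.adj (i + k) hk) (.single _) (by
      rw [Set.disjoint_singleton_right]
      rintro ⟨j, hj, hij⟩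
      have hj' := Set.mem_Ico.1 hj
      have := hv.inj _ (by omega) _ (by omega) hij
      omega)
    have h : Ico i (i + (k + 1) + 1) = Ico i (i + k + 1) ∪ {i + k + 1} := by
      ext z
      simp only [Set.mem_Ico, Set.mem_singleton_iff, Set.mem_union]
      omega
    rwa [h, image_union, image_singleton]

theorem exists_pathOn_tail (hv : IsPathSeq G v n) {s : ℕ} (hs : s < n) :
    ∃ w, PathOn G (v s) w (v '' Ico s n) := by
  have := hv.pathOn_Ico s (n - 1 - s) (by omega)
  rw [show s + (n - 1 - s) + 1 = n by omega] at this
  exact ⟨_, this⟩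

theorem mem_image_iff (hv : IsPathSeq G v n) {s a b : ℕ} (hs : s < n) (hb : b ≤ n) :
    v s ∈ v '' Ico a b ↔ a ≤ s ∧ s < b := by
  constructor
  · rintro ⟨j, hj, hij⟩
    have hj' := Set.mem_Ico.1 hj
    rw [← hv.inj _ (by omega) _ hs hij]
    exact hj
  · exact fun h => ⟨s, h, rfl⟩

end IsPathSeq

/-- Paths `F c`, `c ∈ C`, starting in `x`, disjoint from the path `v` and from each other outside
`x`, whose ends `h c` attach to the vertices preceding the cuts `c` of the path `v`. -/
structure IsFan (G : SimpleGraph V) (v : ℕ → V) (n : ℕ) (x : V) (C : Finset ℕ)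
    (F : ℕ → Set V) (h : ℕ → V) : Prop where
  path : ∀ c ∈ C, PathOn G x (h c) (F c)
  le : ∀ c ∈ C, c ≤ n
  notMem : ∀ c ∈ C, ∀ s < n, v s ∉ F c
  inter : ∀ c ∈ C, ∀ c' ∈ C, c ≠ c' → F c ∩ F c' ⊆ {x}
  adj : ∀ c, c + 1 ∈ C → G.Adj (h (c + 1)) (v c)

namespace IsFan

variable {v : ℕ → V} {n : ℕ} {x : V} {C : Finset ℕ} {F : ℕ → Set V} {h : ℕ → V}

theorem exists_pathOn_prefix (hF : IsFan G v n x C F h) (hv : IsPathSeq G v n) {c : ℕ}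
    (hc : c ∈ C) : ∃ u, PathOn G u x (v '' Ico 0 c ∪ F c) := by
  cases c with
  | zero => exact ⟨h 0, by simpa using (hF.path 0 hc).symm⟩
  | succ c =>
    have hcn := hF.le _ hc
    have := hv.pathOn_Ico 0 c (by omega)
    rw [zero_add] at this
    refine ⟨_, this.append_edge (hF.adj c hc).symm (hF.path _ hc).symm ?_⟩
    rw [Set.disjoint_left]
    rintro _ ⟨i, hi, rfl⟩
    have := Set.mem_Ico.1 hi
    exact hF.notMem _ hc i (by omega)

/-- Follow `v` up to the cut `c`, go to `x`, continue to `v r` along the cut `r + 1` and follow `v`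
to its end. -/
theorem exists_pathOn_skip (hF : IsFan G v n x C F h) (hv : IsPathSeq G v n) {c r : ℕ}
    (hc : c ∈ C) (hr : r + 1 ∈ C) (hcr : c ≤ r) :
    ∃ u w, PathOn G u w (v '' Ico 0 c ∪ F c ∪ F (r + 1) ∪ v '' Ico r n) := by
  have hrn : r < n := hF.le _ hr
  obtain ⟨u, p⟩ := hF.exists_pathOn_prefix hv hc
  obtain ⟨w, q⟩ := hv.exists_pathOn_tail hrn
  have p' := p.glue (hF.path _ hr) (by
    rintro _ ⟨⟨i, hi, rfl⟩ | hz, hz'⟩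
    · have := Set.mem_Ico.1 hi
      exact absurd hz' (hF.notMem _ hr i (by omega))
    · exact hF.inter c hc _ hr (by omega) ⟨hz, hz'⟩)
  refine ⟨u, w, p'.append_edge (hF.adj r hr) q ?_⟩
  rw [Set.disjoint_right]
  rintro _ ⟨i, hi, rfl⟩ ((hz | hz) | hz)
  · have := Set.mem_Ico.1 hi
    rw [hv.mem_image_iff (by omega) (by omega)] at hz
    omega
  · exact hF.notMem _ hc i hi.2 hz
  · exact hF.notMem _ hr i hi.2 hz

/-- Follow `v` up to the cut `c`, go to `x`, continue along `F₁` and a path `L` to `v s` and follow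
`v` to its end. -/
theorem exists_pathOn_jump (hF : IsFan G v n x C F h) (hv : IsPathSeq G v n) {c s : ℕ} {y : V}
    {F₁ L : Set V} (hc : c ∈ C) (hcs : c ≤ s) (hs : s < n) (p₁ : PathOn G x y F₁)
    (hF₁ : F c ∩ F₁ ⊆ {x}) (hF₁v : ∀ i < n, v i ∉ F₁) (pL : PathOn G (v s) y L)
    (hLc : L ∩ F c ⊆ {y}) (hL₁ : L ∩ F₁ ⊆ {y}) (hLv : ∀ i < n, v i ∈ L → i = s) :
    ∃ u w, PathOn G u w (v '' Ico 0 c ∪ F c ∪ F₁ ∪ L ∪ v '' Ico s n) := by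
  obtain ⟨u, p⟩ := hF.exists_pathOn_prefix hv hc
  obtain ⟨w, q⟩ := hv.exists_pathOn_tail hs
  have p' := p.glue p₁ (by
    rintro _ ⟨⟨i, hi, rfl⟩ | hz, hz'⟩
    · have := Set.mem_Ico.1 hi
      exact absurd hz' (hF₁v i (by omega))
    · exact hF₁ ⟨hz, hz'⟩)
  have p'' := p'.glue pL.symm (by
    rintro _ ⟨(⟨i, hi, rfl⟩ | hz) | hz, hz'⟩
    · have := Set.mem_Ico.1 hi
      have := hLv i (by omega) hz'
      omega
    · exact hLc ⟨hz', hz⟩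
    · exact hL₁ ⟨hz', hz⟩)
  refine ⟨u, w, p''.glue q ?_⟩
  rintro _ ⟨((hz | hz) | hz) | hz, ⟨i, hi, rfl⟩⟩
  · have := Set.mem_Ico.1 hi
    rw [hv.mem_image_iff (by omega) (by omega)] at hz
    omega
  · exact absurd hz (hF.notMem _ hc i hi.2)
  · exact absurd hz (hF₁v i hi.2)
  · rw [hLv i hi.2 hz]; rfl

/-- Follow `v` up to the cut `c`, go to `x`, continue along the cut `r + 1`, follow `v` backwards
from `v r` to `v s`, take the path `L` to `v s'` and follow `v` to its end. -/
theorem exists_pathOn_twist (hF : IsFan G v n x C F h) (hv : IsPathSeq G v n) {c r s s' : ℕ}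
    {L : Set V} (hc : c ∈ C) (hr : r + 1 ∈ C) (hcs : c ≤ s) (hsr : s ≤ r) (hrs' : r < s')
    (hs' : s' < n) (pL : PathOn G (v s) (v s') L) (hLc : Disjoint L (F c))
    (hLr : Disjoint L (F (r + 1))) (hLv : ∀ i < n, v i ∈ L → i = s ∨ i = s') :
    ∃ u w, PathOn G u w
      (v '' Ico 0 c ∪ F c ∪ F (r + 1) ∪ v '' Ico s (r + 1) ∪ L ∪ v '' Ico s' n) := by
  obtain ⟨u, p⟩ := hF.exists_pathOn_prefix hv hc
  obtain ⟨w, q⟩ := hv.exists_pathOn_tail hs'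
  have q' := hv.pathOn_Ico s (r - s) (by omega)
  rw [show s + (r - s) = r by omega] at q'
  have p' := p.glue (hF.path _ hr) (by
    rintro _ ⟨⟨i, hi, rfl⟩ | hz, hz'⟩
    · have := Set.mem_Ico.1 hi
      exact absurd hz' (hF.notMem _ hr i (by omega))
    · exact hF.inter c hc _ hr (by omega) ⟨hz, hz'⟩)
  have p'' := p'.append_edge (hF.adj r hr) q'.symm (by
    rw [Set.disjoint_right]
    rintro _ ⟨i, hi, rfl⟩ ((hz | hz) | hz)
    all_goals have hi' := Set.mem_Ico.1 hi
    · rw [hv.mem_image_iff (by omega) (by omega)] at hz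
      omega
    · exact hF.notMem _ hc i (by omega) hz
    · exact hF.notMem _ hr i (by omega) hz)
  have p₃ := p''.glue pL (by
    rintro _ ⟨((⟨i, hi, rfl⟩ | hz) | hz) | ⟨i, hi, rfl⟩, hz'⟩
    · have := Set.mem_Ico.1 hi
      have := hLv i (by omega) hz'
      omega
    · exact absurd hz (Set.disjoint_left.1 hLc hz')
    · exact absurd hz (Set.disjoint_left.1 hLr hz')
    · have := Set.mem_Ico.1 hi
      obtain rfl | rfl := hLv i (by omega) hz'
      · rfl
      · omega)
  refine ⟨u, w, p₃.glue q ?_⟩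
  rintro _ ⟨(((hz | hz) | hz) | hz) | hz, ⟨i, hi, rfl⟩⟩
  all_goals have hi' := Set.mem_Ico.1 hi
  · rw [hv.mem_image_iff (by omega) (by omega)] at hz
    omega
  · exact absurd hz (hF.notMem _ hc i hi.2)
  · exact absurd hz (hF.notMem _ hr i hi.2)
  · rw [hv.mem_image_iff (by omega) (by omega)] at hz
    omega
  · obtain rfl | rfl := hLv i hi.2 hz
    · omega
    · rfl

end IsFan

/-- The path `v` covers all of `S` but `A` and `x`, every path of `G` leaves a part of `S` of
independence number larger than `b` uncovered, and `A` itself has independence number `b`. -/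
structure IsTightPath (G : SimpleGraph V) (S : Set V) (v : ℕ → V) (n : ℕ) (x : V) (A : Set V)
    (b : ℕ) : Prop where
  isPathSeq : IsPathSeq G v n
  lt_of_pathOn : ∀ {u w : V} {Q : Set V}, PathOn G u w Q → b < indepNumOn G (S \ Q)
  cover : ∀ z ∈ S, z ∈ A ∨ z = x ∨ ∃ i < n, v i = z
  subset : A ⊆ S
  mem : x ∈ S
  notMem : x ∉ A
  notMem_path : ∀ i < n, v i ∉ A
  ne : ∀ i < n, v i ≠ x
  eq : indepNumOn G A = b
  lt_union : b < indepNumOn G (A ∪ {x})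

theorem IsFan.exists_reroute {v : ℕ → V} {n : ℕ} {x y : V} {C : Finset ℕ} {F : ℕ → Set V}
    {h : ℕ → V} {L : Set V} {c s : ℕ} (hF : IsFan G v n x C F h) (hc : c ∈ C) (hs : s < n)
    (hy : y ∈ F c) (hyx : y ≠ x) (pL : PathOn G (v s) y L) (hLF : ∀ m ∈ C, L ∩ F m ⊆ {y})
    (hLv : ∀ i < n, v i ∈ L → v i = v s) :
    ∃ F' h', IsFan G v n x (insert (s + 1) (C.erase c)) F' h' := by
  obtain ⟨F₁, F₂, p₁, -, hF₁, -⟩ := (hF.path c hc).split hy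
  replace hF₁ : F₁ ⊆ F c := hF₁ ▸ subset_union_left
  obtain ⟨g, hg, q⟩ := pL.uncons fun e => hF.notMem c hc s hs (e ▸ hy)
  have hp := p₁.glue q.symm fun z hz => hLF c hc ⟨hz.2.1, hF₁ hz.1⟩
  have hnew : ∀ m ∈ C, m ≠ c → (F₁ ∪ L \ {v s}) ∩ F m ⊆ {x} := by
    rintro m hm hmc z ⟨hz | hz, hz'⟩
    · exact hF.inter c hc m hm hmc.symm ⟨hF₁ hz, hz'⟩
    · obtain rfl : z = y := hLF m hm ⟨hz.1, hz'⟩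
      exact absurd (hF.inter c hc m hm hmc.symm ⟨hy, hz'⟩) hyx
  classical
  refine ⟨fun m => if m = s + 1 then F₁ ∪ L \ {v s} else F m,
    fun m => if m = s + 1 then g else h m, ?_, ?_, ?_, ?_, ?_⟩
  · intro m hm
    by_cases e : m = s + 1
    · simpa only [if_pos e] using hp
    · simp only [if_neg e]
      exact hF.path m (Finset.mem_of_mem_erase (Finset.mem_of_mem_insert_of_ne hm e))
  · intro m hm
    by_cases e : m = s + 1
    · omega
    · exact hF.le m (Finset.mem_of_mem_erase (Finset.mem_of_mem_insert_of_ne hm e))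
  · intro m hm i hi
    by_cases e : m = s + 1
    · simp only [if_pos e]
      rintro (hz | hz)
      · exact hF.notMem c hc i hi (hF₁ hz)
      · exact hz.2 (hLv i hi hz.1)
    · simp only [if_neg e]
      exact hF.notMem m (Finset.mem_of_mem_erase (Finset.mem_of_mem_insert_of_ne hm e)) i hi
  · intro m hm m' hm' hne
    by_cases e : m = s + 1 <;> by_cases e' : m' = s + 1
    · omega
    · have h1 := Finset.mem_erase.1 (Finset.mem_of_mem_insert_of_ne hm' e')
      simpa only [if_pos e, if_neg e'] using hnew m' h1.2 h1.1
    · have h1 := Finset.mem_erase.1 (Finset.mem_of_mem_insert_of_ne hm e)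
      simpa only [if_pos e', if_neg e, Set.inter_comm] using hnew m h1.2 h1.1
    · simp only [if_neg e, if_neg e']
      exact hF.inter m (Finset.mem_of_mem_erase (Finset.mem_of_mem_insert_of_ne hm e)) m'
        (Finset.mem_of_mem_erase (Finset.mem_of_mem_insert_of_ne hm' e')) hne
  · intro m hm
    by_cases e : m = s
    · simpa [e] using hg.symm
    · have e' : m + 1 ≠ s + 1 := by omega
      simp only [if_neg e']
      exact hF.adj m (Finset.mem_of_mem_erase (Finset.mem_of_mem_insert_of_ne hm e'))

namespace IsTightPath

variable {S A : Set V} {v : ℕ → V} {n b : ℕ} {x : V} {C : Finset ℕ} {F : ℕ → Set V} {h : ℕ → V}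

theorem lt_indepNumOn_union [Finite V] (ht : IsTightPath G S v n x A b) {u w : V} {Q Z : Set V}
    (p : PathOn G u w Q) (hx : x ∈ Q) (hZ : ∀ i < n, v i ∈ S → v i ∈ Q ∨ v i ∈ Z) :
    b < indepNumOn G (A ∪ Z) := by
  refine (ht.lt_of_pathOn p).trans_le (indepNumOn_mono ?_)
  rintro z ⟨hz, hzQ⟩
  rcases ht.cover z hz with hzA | rfl | ⟨i, hi, rfl⟩
  · exact Or.inl hzA
  · exact absurd hx hzQ
  · exact Or.inr ((hZ i hi hz).resolve_left hzQ)

theorem lt_indepNumOn_seg [Finite V] (ht : IsTightPath G S v n x A b) (hF : IsFan G v n x C F h)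
    {c : ℕ} (hc : c ∈ C) : b < indepNumOn G (A ∪ S ∩ v '' Ico c n) := by
  obtain ⟨u, p⟩ := hF.exists_pathOn_prefix ht.isPathSeq hc
  refine ht.lt_indepNumOn_union p (Or.inr (hF.path c hc).start_mem) fun i hi hiS => ?_
  rcases lt_or_ge i c with hic | hic
  · exact Or.inl (Or.inl ⟨i, ⟨i.zero_le, hic⟩, rfl⟩)
  · exact Or.inr ⟨hiS, i, ⟨hic, hi⟩, rfl⟩

theorem lt_indepNumOn_seg_of_lt [Finite V] (ht : IsTightPath G S v n x A b)
    (hF : IsFan G v n x C F h) {c r : ℕ} (hc : c ∈ C) (hr : r + 1 ∈ C) (hcr : c ≤ r) :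
    b < indepNumOn G (A ∪ S ∩ v '' Ico c r) := by
  obtain ⟨u, w, p⟩ := hF.exists_pathOn_skip ht.isPathSeq hc hr hcr
  refine ht.lt_indepNumOn_union p (Or.inl (Or.inl (Or.inr (hF.path c hc).start_mem)))
    fun i hi hiS => ?_
  rcases lt_or_ge i c with hic | hic
  · exact Or.inl (Or.inl (Or.inl (Or.inl ⟨i, ⟨i.zero_le, hic⟩, rfl⟩)))
  rcases lt_or_ge i r with hir | hir
  · exact Or.inr ⟨hiS, i, ⟨hic, hir⟩, rfl⟩
  · exact Or.inl (Or.inr ⟨i, ⟨hir, hi⟩, rfl⟩)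

/-- In a fan whose cuts lie as far along `v` as possible, the part of `v` following a cut is not
linked to the fan through `A`. -/
theorem not_linkedVia_of_mem_fan [Finite V] (ht : IsTightPath G S v n x A b)
    (hF : IsFan G v n x C F h)
    (hmax : ∀ C' F' h', IsFan G v n x C' F' h' → C'.card = C.card → ∑ c ∈ C', c ≤ ∑ c ∈ C, c)
    {c s m : ℕ} {y : V} (hc : c ∈ C) (hcs : c ≤ s) (hs : s < n) (hsC : s + 1 ∉ C)
    (hb : indepNumOn G (A ∪ S ∩ v '' Ico c s) ≤ b) (hm : m ∈ C) (hy : y ∈ F m) :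
    ¬ LinkedVia G A (v s) y := by
  rintro ⟨L₀, pL₀, hL₀⟩
  obtain ⟨y', L, hLL₀, pL, hL⟩ :=
    pL₀.exists_first_hit (U := ⋃ i ∈ C, F i) (Set.mem_biUnion hm hy)
  have hLF : ∀ i ∈ C, L ∩ F i ⊆ {y'} := fun i hi z hz =>
    hL ▸ (⟨hz.1, Set.mem_biUnion hi hz.2⟩ : z ∈ L ∩ ⋃ i ∈ C, F i)
  have hLv : ∀ i < n, v i ∈ L → v i = v s := by
    intro i hi hiL
    rcases hL₀ (hLL₀ hiL) with hA | hs' | hy'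
    · exact absurd hA (ht.notMem_path i hi)
    · exact hs'
    · exact absurd ((show v i = y from hy') ▸ hy) (hF.notMem m hm i hi)
  have hLv' : ∀ i < n, v i ∈ L → i = s := fun i hi hiL =>
    ht.isPathSeq.inj i hi s hs (hLv i hi hiL)
  have hjump : ∀ F₁, PathOn G x y' F₁ → F c ∩ F₁ ⊆ {x} → (∀ i < n, v i ∉ F₁) →
      L ∩ F₁ ⊆ {y'} → False := by
    intro F₁ p₁ h1 h2 h3
    obtain ⟨u, w, p⟩ := hF.exists_pathOn_jump ht.isPathSeq hc hcs hs p₁ h1 h2 pL (hLF c hc) h3 hLv'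
    refine hb.not_gt (ht.lt_indepNumOn_union p
      (Or.inl (Or.inl (Or.inl (Or.inr (hF.path c hc).start_mem)))) fun i hi hiS => ?_)
    rcases lt_or_ge i c with hic | hic
    · exact Or.inl (Or.inl (Or.inl (Or.inl (Or.inl ⟨i, ⟨i.zero_le, hic⟩, rfl⟩))))
    rcases lt_or_ge i s with his | his
    · exact Or.inr ⟨hiS, i, ⟨hic, his⟩, rfl⟩
    · exact Or.inl (Or.inr ⟨i, ⟨his, hi⟩, rfl⟩)
  have hyL : y' ∈ L ∩ ⋃ i ∈ C, F i := hL ▸ rfl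
  obtain ⟨m', hm', hy'⟩ := Set.mem_iUnion₂.1 hyL.2
  by_cases hyx : y' = x
  · subst hyx
    exact hjump {y'} (.single y') Set.inter_subset_right (fun i hi => ht.ne i hi)
      Set.inter_subset_right
  by_cases hmc : m' = c
  · subst hmc
    obtain ⟨F', h', hF'⟩ := hF.exists_reroute hc hs hy' hyx pL hLF hLv
    have hsC' : s + 1 ∉ C.erase m' := fun h => hsC (Finset.mem_of_mem_erase h)
    have := hmax _ F' h' hF' (by
      rw [Finset.card_insert_of_notMem hsC', Finset.card_erase_add_one hc])
    rw [Finset.sum_insert hsC', ← Finset.add_sum_erase C _ hc] at this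
    omega
  · obtain ⟨F₁, F₂, p₁, -, hF₁, -⟩ := (hF.path m' hm').split hy'
    replace hF₁ : F₁ ⊆ F m' := hF₁ ▸ subset_union_left
    exact hjump F₁ p₁
      (fun z hz => hF.inter c hc m' hm' (Ne.symm hmc) ⟨hz.1, hF₁ hz.2⟩)
      (fun i hi hz => hF.notMem m' hm' i hi (hF₁ hz))
      (fun z hz => hLF m' hm' ⟨hz.1, hF₁ hz.2⟩)

theorem not_linkedVia_of_segs [Finite V] (ht : IsTightPath G S v n x A b)
    (hF : IsFan G v n x C F h) {c r t t' : ℕ} (hc : c ∈ C) (hr : r + 1 ∈ C) (htr : t ≤ r)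
    (ht' : t' ≤ n) (hb : ∀ s < t, indepNumOn G (A ∪ S ∩ v '' Ico c s) ≤ b)
    (hb' : ∀ s < t', indepNumOn G (A ∪ S ∩ v '' Ico (r + 1) s) ≤ b)
    (hfan : ∀ s, c ≤ s → s < t → v s ∈ S → ∀ m ∈ C, ∀ y ∈ F m, ¬ LinkedVia G A (v s) y) :
    ∀ z ∈ S ∩ v '' Ico c t, ∀ z' ∈ S ∩ v '' Ico (r + 1) t', ¬ LinkedVia G A z z' := by
  classical
  rintro z ⟨hz, s₁, hs₁, rfl⟩ z' ⟨hz', s₁', hs₁', rfl⟩ hlink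
  have hex : ∃ s, c ≤ s ∧ s < t ∧ v s ∈ S ∧ ∃ s', r + 1 ≤ s' ∧ s' < t' ∧ v s' ∈ S ∧
      LinkedVia G A (v s) (v s') := ⟨s₁, hs₁.1, hs₁.2, hz, s₁', hs₁'.1, hs₁'.2, hz', hlink⟩
  obtain ⟨hcs, hst, hsS, s', hrs', hs't, hs'S, L, pL, hL⟩ := Nat.find_spec hex
  have hmin := fun i (hi : i < Nat.find hex) => Nat.find_min hex hi
  set s := Nat.find hex
  have hrn : r < n := hF.le _ hr
  have hLF : ∀ m ∈ C, Disjoint L (F m) := by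
    intro m hm
    rw [Set.disjoint_left]
    intro y hyL hyF
    obtain ⟨L₁, L₂, p₁, p₂, h12, hi12⟩ := pL.split hyL
    refine hfan s hcs hst hsS m hm y hyF ⟨L₁, p₁, fun z hz => ?_⟩
    rcases hL (h12.subset (Or.inl hz)) with h | h | h
    · exact Or.inl h
    · exact Or.inr (Or.inl h)
    · obtain rfl : z = v s' := h
      have : v s' ∈ L₁ ∩ L₂ := ⟨hz, p₂.end_mem⟩
      rw [hi12] at this
      exact Or.inr (Or.inr this)
  have hsum := indepNumOn_union_add (G := G) (A := A) (Z := S ∩ v '' Ico c s)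
    (Z' := S ∩ v '' Ico (r + 1) s') (by
      rintro _ ⟨hi, i, hi', rfl⟩ _ ⟨hj, j, hj', rfl⟩ hij
      have := Set.mem_Ico.1 hi'
      have := Set.mem_Ico.1 hj'
      exact hmin i (by omega) ⟨by omega, by omega, hi, j, by omega, by omega, hj, hij⟩)
    (by
      rw [Set.disjoint_left]
      rintro _ ⟨-, i, hi, rfl⟩
      have := Set.mem_Ico.1 hi
      exact ht.notMem_path i (by omega))
    (by
      rw [Set.disjoint_left]
      rintro _ ⟨-, i, hi, rfl⟩
      have := Set.mem_Ico.1 hi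
      exact ht.notMem_path i (by omega))
  obtain ⟨u, w, p⟩ := hF.exists_pathOn_twist ht.isPathSeq hc hr hcs (by omega) hrs'
    (by omega) pL (hLF c hc) (hLF _ hr) (by
      intro i hi hiL
      rcases hL hiL with h | h | h
      · exact absurd h (ht.notMem_path i hi)
      · exact Or.inl (ht.isPathSeq.inj i hi s (by omega) h)
      · exact Or.inr (ht.isPathSeq.inj i hi s' (by omega) h))
  have := ht.lt_indepNumOn_union (Z := S ∩ v '' Ico c s ∪ S ∩ v '' Ico (r + 1) s') p
    (Or.inl (Or.inl (Or.inl (Or.inl (Or.inr (hF.path c hc).start_mem))))) fun i hi hiS => by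
      rcases lt_or_ge i c with h1 | h1
      · exact Or.inl (Or.inl (Or.inl (Or.inl (Or.inl (Or.inl ⟨i, ⟨i.zero_le, h1⟩, rfl⟩)))))
      rcases lt_or_ge i s with h2 | h2
      · exact Or.inr (Or.inl ⟨hiS, i, ⟨h1, h2⟩, rfl⟩)
      rcases lt_or_ge i (r + 1) with h3 | h3
      · exact Or.inl (Or.inl (Or.inl (Or.inr ⟨i, ⟨h2, h3⟩, rfl⟩)))
      rcases lt_or_ge i s' with h4 | h4
      · exact Or.inr (Or.inr ⟨hiS, i, ⟨h3, h4⟩, rfl⟩)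
      · exact Or.inl (Or.inr ⟨i, ⟨h4, hi⟩, rfl⟩)
  have h1 := hb s hst
  have h2 := hb' s' hs't
  have h3 := ht.eq
  omega

/-- A fan with `f + 1` cuts gives `f + 1` vertices of `S` on the path `v` and `f + 1` independent
vertices of `S` beyond the `b + 1` provided by `A` and `x`. -/
theorem card_le_of_isFan [Finite V] (ht : IsTightPath G S v n x A b)
    (hF : IsFan G v n x C F h) :
    C.card ≤ (S ∩ v '' Ico 0 n).ncard ∧ b + 1 + C.card ≤ indepNumOn G S := by
  classical
  wlog hmax : ∀ C' F' h', IsFan G v n x C' F' h' → C'.card = C.card →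
      ∑ c ∈ C', c ≤ ∑ c ∈ C, c with H
  · obtain ⟨C', F', h', hF', hcard, hsum⟩ := Nat.sSup_mem
      (s := {k | ∃ C' F' h', IsFan G v n x C' F' h' ∧ C'.card = C.card ∧ ∑ c ∈ C', c = k})
      ⟨_, C, F, h, hF, rfl, rfl⟩ ⟨C.card * n, by
        rintro k ⟨C', F', h', hF', hcard, rfl⟩
        rw [← hcard, ← smul_eq_mul]
        exact Finset.sum_le_card_nsmul _ _ _ hF'.le⟩
    rw [← hcard]
    refine H ht hF' fun C'' F'' h'' hF'' hcard' => ?_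
    rw [hsum]
    refine le_csSup ⟨C.card * n, ?_⟩ ⟨C'', F'', h'', hF'', hcard'.trans hcard, rfl⟩
    rintro k ⟨C', F', h', hF', hcard, rfl⟩
    rw [← hcard, ← smul_eq_mul]
    exact Finset.sum_le_card_nsmul _ _ _ hF'.le
  have hW : ∀ c : ℕ, ∃ t, c ∈ C → b < indepNumOn G (A ∪ S ∩ v '' Ico c t) ∧
      (∀ s < t, indepNumOn G (A ∪ S ∩ v '' Ico c s) ≤ b) ∧ c < t ∧ t ≤ n ∧
      ∀ r, r + 1 ∈ C → c ≤ r → t ≤ r := by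
    intro c
    by_cases hc : c ∈ C
    swap
    · exact ⟨0, fun h => absurd h hc⟩
    have hex : ∃ t, b < indepNumOn G (A ∪ S ∩ v '' Ico c t) := ⟨n, ht.lt_indepNumOn_seg hF hc⟩
    refine ⟨Nat.find hex, fun _ => ⟨Nat.find_spec hex, fun s hs => not_lt.1 (Nat.find_min hex hs),
      ?_, Nat.find_min' hex (ht.lt_indepNumOn_seg hF hc),
      fun r hr hcr => Nat.find_min' hex (ht.lt_indepNumOn_seg_of_lt hF hc hr hcr)⟩⟩
    by_contra hle
    have := Nat.find_spec hex
    rw [Set.Ico_eq_empty hle, image_empty, inter_empty, union_empty, ht.eq] at this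
    exact this.ne rfl
  choose W hW using hW
  have hWlt : ∀ c ∈ C, ∀ c' ∈ C, c < c' → W c < c' := by
    intro c hc c' hc' hlt
    have := (hW c hc).2.2.2.2 (c' - 1) (by rwa [Nat.sub_add_cancel (by omega)]) (by omega)
    omega
  have hfan : ∀ c ∈ C, ∀ s, c ≤ s → s < W c → v s ∈ S → ∀ m ∈ C, ∀ y ∈ F m,
      ¬ LinkedVia G A (v s) y := by
    intro c hc s hcs hsW _ m hm y hy
    obtain ⟨-, hb, -, hWn, -⟩ := hW c hc
    refine ht.not_linkedVia_of_mem_fan hF hmax hc hcs (by omega) (fun hs => ?_) (hb s hsW) hm hy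
    have := hWlt c hc _ hs (by omega)
    omega
  constructor
  · rw [← Set.ncard_coe_finset]
    refine Set.ncard_le_ncard_of_injOn (fun c => v (W c - 1)) ?_ ?_
    · intro c hc
      obtain ⟨hlt, hb, hcW, hWn, -⟩ := hW c hc
      refine ⟨?_, W c - 1, ⟨by omega, by omega⟩, rfl⟩
      by_contra hnS
      refine (hb (W c - 1) (by omega)).not_gt (hlt.trans_le (indepNumOn_mono ?_))
      refine Set.union_subset_union_right _ ?_
      rintro _ ⟨hi, i, hi', rfl⟩
      have := Set.mem_Ico.1 hi'
      refine ⟨hi, i, ⟨by omega, ?_⟩, rfl⟩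
      rcases eq_or_ne i (W c - 1) with rfl | hne
      · exact absurd hi hnS
      · omega
    · intro c hc c' hc' hcc'
      obtain ⟨-, -, hcW, hWn, -⟩ := hW c hc
      obtain ⟨-, -, hcW', hWn', -⟩ := hW c' hc'
      have := ht.isPathSeq.inj _ (by omega) _ (by omega) hcc'
      rcases lt_trichotomy c c' with hlt | heq | hgt
      · have := hWlt c hc c' hc' hlt
        omega
      · exact heq
      · have := hWlt c' hc' c hc hgt
        omega
  · have hpair : ∀ c ∈ C, ∀ c' ∈ C, c < c' → ∀ z ∈ S ∩ v '' Ico c (W c),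
        ∀ z' ∈ S ∩ v '' Ico c' (W c'), ¬ LinkedVia G A z z' := by
      intro c hc c' hc' hlt
      obtain ⟨r, rfl⟩ : ∃ r, c' = r + 1 := ⟨c' - 1, by omega⟩
      have := hWlt c hc _ hc' hlt
      exact ht.not_linkedVia_of_segs hF hc hc' (by omega) (hW _ hc').2.2.2.1 (hW c hc).2.1
        (hW _ hc').2.1 (hfan c hc)
    have hnone : ∀ c ∈ C, ∀ z ∈ S ∩ v '' Ico c (W c), ¬ LinkedVia G A z x := by
      rintro c hc _ ⟨hz, s, hs, rfl⟩
      exact hfan c hc s hs.1 hs.2 hz c hc x (hF.path c hc).start_mem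
    have := add_card_le_indepNumOn_biUnion (G := G) (A := A) (Finset.insertNone C)
      (fun o => o.elim {x} fun c => S ∩ v '' Ico c (W c)) (by
        rintro (_ | c) hc
        · rw [ht.eq]; exact ht.lt_union
        · rw [ht.eq]; exact (hW c (Finset.some_mem_insertNone.1 hc)).1) (by
        rintro (_ | c) hc
        · exact Set.disjoint_singleton_left.2 ht.notMem
        · obtain ⟨-, -, -, hWn, -⟩ := hW c (Finset.some_mem_insertNone.1 hc)
          refine Set.disjoint_left.2 ?_
          rintro _ ⟨-, i, hi, rfl⟩
          have := Set.mem_Ico.1 hi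
          exact ht.notMem_path i (by omega)) (by
        rintro (_ | c) hc (_ | c') hc' hne z hz z' hz' hl
        · exact hne rfl
        · obtain rfl : z = x := hz
          exact hnone c' (Finset.some_mem_insertNone.1 hc') z' hz' hl.symm
        · obtain rfl : z' = x := hz'
          exact hnone c (Finset.some_mem_insertNone.1 hc) z hz hl
        · rw [Finset.some_mem_insertNone] at hc hc'
          rcases lt_trichotomy c c' with hlt | rfl | hgt
          · exact hpair c hc c' hc' hlt z hz z' hz' hl
          · exact hne rfl
          · exact hpair c' hc' c hc hgt z' hz' z hz hl.symm)
    rw [ht.eq, Finset.card_insertNone] at this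
    calc b + 1 + C.card = b + (C.card + 1) := by ring
      _ ≤ _ := this
      _ ≤ _ := indepNumOn_mono (Set.union_subset ht.subset (Set.iUnion₂_subset ?_))
    rintro (_ | c) hc
    · exact Set.singleton_subset_iff.2 ht.mem
    · exact Set.inter_subset_left

end IsTightPath

theorem min_le_ncard_of_separates [Finite V] {S B X : Set V} {x : V} {m : ℕ}
    (hm : ∀ y ∈ S, y ≠ x → m ≤ localConn G x y) (hx : x ∉ B)
    (hX : Separates (G.deleteIncidenceSet x) (G.neighborSet x) B X) :
    min m (S ∩ B).ncard ≤ X.ncard := by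
  by_contra! hlt
  obtain ⟨hlt₁, hlt₂⟩ := lt_min_iff.1 hlt
  obtain ⟨y, ⟨hyS, hyB⟩, hyX⟩ := Set.exists_mem_notMem_of_ncard_lt_ncard hlt₂
  have hyx : y ≠ x := fun e => hx (e ▸ hyB)
  obtain ⟨_, ⟨P, hP, rfl⟩, hlt'⟩ := exists_lt_of_lt_csSup (by exact ⟨0, ∅, by simp⟩)
    (hlt₁.trans_le (hm y hyS hyx))
  have hex : ∀ p : G.Path x y, ∃ z ∈ p.1.support, z ≠ x ∧ z ∈ X := by
    intro p
    obtain ⟨u, hu, q⟩ := (PathOn.of_isPath p.1 p.2).uncons hyx.symm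
    obtain ⟨z, ⟨hz, hzx⟩, hzX⟩ := hX u hu y hyB _ (q.mono_on fun a ha b hb hab =>
      deleteIncidenceSet_adj.2 ⟨hab, ha.2, hb.2⟩)
    exact ⟨z, hz, hzx, hzX⟩
  choose z hz hzx hzX using hex
  refine hlt'.not_ge (Set.ncard_le_ncard_of_injOn z (fun p _ => hzX p) fun p hp q hq hpq => ?_)
  by_contra hne
  rcases hP hp hq hne (z p) (hz p) (hpq ▸ hz q) with h | h
  · exact hzx p h
  · exact hyX (h ▸ hzX p)

theorem exists_isFan [Finite V] {S : Set V} {v : ℕ → V} {n m : ℕ} {x : V}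
    (hx : ∀ i < n, v i ≠ x) (hm : ∀ y ∈ S, y ≠ x → m ≤ localConn G x y) :
    ∃ C F h, IsFan G v n x C F h ∧ C.card = min m (S ∩ v '' Ico 0 n).ncard + 1 := by
  have hxP : x ∉ v '' Ico 0 n := by
    rintro ⟨i, hi, e⟩
    exact hx i hi.2 e
  obtain ⟨a, b, F, ha, hb, hp, hd⟩ := hasLinkage_of_forall_separates (G.deleteIncidenceSet x)
    (G.neighborSet x) (v '' Ico 0 n) (min m (S ∩ v '' Ico 0 n).ncard)
    fun X hX => min_le_ncard_of_separates hm hxP hX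
  have hex : ∀ i, ∃ s g E, s < n ∧ G.Adj g (v s) ∧ PathOn G x g E ∧ E ⊆ insert x (F i) ∧
      v s ∈ F i ∧ ∀ j < n, v j ∉ E := by
    intro i
    obtain ⟨y, F₀, hF₀, p, hI⟩ := (hp i).exists_first_hit (hb i)
    have hy : y ∈ F₀ ∩ v '' Ico 0 n := hI ▸ rfl
    obtain ⟨s, hs, rfl⟩ := hy.2
    have hxF₀ : x ∉ F₀ := by
      intro hxF
      obtain ⟨F₁, F₂, -, q, -, -⟩ := p.split hxF
      obtain ⟨u, hu, -⟩ := q.uncons (hx s hs.2).symm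
      exact (deleteIncidenceSet_adj.1 hu).2.1 rfl
    obtain ⟨g, hg, q⟩ := ((p.mono (deleteIncidenceSet_le G x)).symm.append_edge
      (ha i).symm (.single x) (Set.disjoint_singleton_right.2 hxF₀)).uncons (hx s hs.2)
    refine ⟨s, g, _, hs.2, hg.symm, q.symm, ?_, hF₀ hy.1, ?_⟩
    · rintro z ⟨hz | hz, -⟩
      · exact Or.inr (hF₀ hz)
      · exact Or.inl hz
    · rintro j hj ⟨hz | hz, hne⟩
      · exact hne (hI ▸ (⟨hz, j, ⟨j.zero_le, hj⟩, rfl⟩ : v j ∈ F₀ ∩ v '' Ico 0 n))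
      · exact hx j hj hz
  choose s g E hs hg hq hE hsF hvE using hex
  have hinj : Function.Injective fun i => s i + 1 := by
    intro i j hij
    by_contra hne
    have hij' : s i = s j := by simpa using hij
    exact Set.disjoint_left.1 (hd i j hne) (hsF i) (hij' ▸ hsF j)
  have h0 : ¬ ∃ i, s i + 1 = 0 := by simp
  classical
  refine ⟨insert 0 (Finset.univ.image fun i => s i + 1),
    Function.extend (fun i => s i + 1) E fun _ => {x},
    Function.extend (fun i => s i + 1) g fun _ => x, ⟨?_, ?_, ?_, ?_, ?_⟩, ?_⟩
  · intro c hc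
    obtain rfl | ⟨i, rfl⟩ : c = 0 ∨ ∃ i, s i + 1 = c := by simpa using hc
    · rw [Function.extend_apply' _ _ _ h0, Function.extend_apply' _ _ _ h0]
      exact .single x
    · rw [hinj.extend_apply, hinj.extend_apply]
      exact hq i
  · intro c hc
    obtain rfl | ⟨i, rfl⟩ : c = 0 ∨ ∃ i, s i + 1 = c := by simpa using hc
    · exact n.zero_le
    · exact hs i
  · intro c hc j hj
    obtain rfl | ⟨i, rfl⟩ : c = 0 ∨ ∃ i, s i + 1 = c := by simpa using hc
    · rw [Function.extend_apply' _ _ _ h0]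
      exact hx j hj
    · rw [hinj.extend_apply]
      exact hvE i j hj
  · intro c hc c' hc' hne
    obtain rfl | ⟨i, rfl⟩ : c = 0 ∨ ∃ i, s i + 1 = c := by simpa using hc
    · rw [Function.extend_apply' _ _ _ h0]
      exact Set.inter_subset_left
    obtain rfl | ⟨j, rfl⟩ : c' = 0 ∨ ∃ i, s i + 1 = c' := by simpa using hc'
    · rw [Function.extend_apply' (f := fun i => s i + 1) _ _ 0 h0]
      exact Set.inter_subset_right
    rw [hinj.extend_apply, hinj.extend_apply]
    rintro z ⟨hz, hz'⟩
    rcases hE i hz with h | h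
    · exact h
    rcases hE j hz' with h' | h'
    · exact h'
    exact absurd h' (Set.disjoint_left.1 (hd i j fun e => hne (by rw [e])) h)
  · intro c hc
    obtain ⟨i, hi⟩ : ∃ i, s i = c := by simpa using hc
    subst hi
    rw [hinj.extend_apply (f := fun i => s i + 1) g _ i]
    exact hg i
  · rw [Finset.card_insert_of_notMem (by simp), Finset.card_image_of_injective _ hinj,
      Finset.card_univ, Fintype.card_fin]

theorem exists_pathOn_indepNumOn_add_le [Finite V] [Nonempty V] (G : SimpleGraph V) (S : Set V) :
    ∃ u w F, PathOn G u w F ∧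
      (S ⊆ F ∨ (indepNumOn G (S \ F) : ℕ∞) + setConn G S + 2 ≤ (indepNumOn G S : ℕ∞) + 1) := by
  classical
  have hex : ∃ a u w F, PathOn G u w F ∧ indepNumOn G (S \ F) = a :=
    ⟨_, _, _, _, .single (Classical.arbitrary V), rfl⟩
  obtain ⟨u, w, F, p, hF⟩ := Nat.find_spec hex
  refine ⟨u, w, F, p, ?_⟩
  rcases Nat.eq_zero_or_eq_succ_pred (Nat.find hex) with h0 | hb
  · left
    rw [h0] at hF
    by_contra hS
    exact (indepNumOn_pos (G := G) (Set.sdiff_nonempty.2 hS)).ne' hF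
  right
  have hmin : ∀ {u w F}, PathOn G u w F → Nat.find hex ≤ indepNumOn G (S \ F) :=
    fun p => Nat.find_min' hex ⟨_, _, _, p, rfl⟩
  rw [hF]
  generalize Nat.find hex = a at hb hmin
  generalize a.pred = b at hb
  subst hb
  have hex₀ : ∃ k, ∃ S₀ ⊆ S, S₀.ncard = k ∧
      ∀ {u w F}, PathOn G u w F → b < indepNumOn G (S₀ \ F) := ⟨_, S, Subset.rfl, rfl, hmin⟩
  obtain ⟨S₀, hS₀, hcard, hno⟩ := Nat.find_spec hex₀
  obtain ⟨x, hx⟩ : S₀.Nonempty := by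
    rw [Set.nonempty_iff_ne_empty]
    rintro rfl
    have := hno p
    rw [Set.empty_sdiff, indepNumOn_empty] at this
    exact absurd this b.not_lt_zero
  obtain ⟨u₁, w₁, P, q, hP⟩ : ∃ u w P, PathOn G u w P ∧ indepNumOn G ((S₀ \ {x}) \ P) ≤ b := by
    by_contra! h
    have hle := Nat.find_min' hex₀ ⟨S₀ \ {x}, Set.sdiff_subset.trans hS₀, rfl,
      fun p => h _ _ _ p⟩
    rw [← hcard] at hle
    exact hle.not_gt (Set.ncard_sdiff_singleton_lt_of_mem hx)
  have hxP : x ∉ P := by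
    intro hxP
    refine hP.not_gt ((hno q).trans_le
      (indepNumOn_mono fun z hz => ⟨⟨hz.1, fun e => hz.2 ?_⟩, hz.2⟩))
    rwa [Set.mem_singleton_iff.1 e]
  obtain ⟨v, n, hv, -, rfl⟩ := q.exists_isPathSeq
  have hlt : b < indepNumOn G ((S₀ \ {x}) \ v '' Ico 0 (n + 1) ∪ {x}) := by
    refine (hno q).trans_le (indepNumOn_mono fun z hz => ?_)
    by_cases hzx : z = x
    · exact Or.inr hzx
    · exact Or.inl ⟨⟨hz.1, hzx⟩, hz.2⟩
  have ht : IsTightPath G S₀ v (n + 1) x ((S₀ \ {x}) \ v '' Ico 0 (n + 1)) b :=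
    { isPathSeq := hv
      lt_of_pathOn := hno
      cover := by
        intro z hz
        by_cases hzx : z = x
        · exact Or.inr (Or.inl hzx)
        by_cases hzP : z ∈ v '' Ico 0 (n + 1)
        · obtain ⟨i, hi, rfl⟩ := hzP
          exact Or.inr (Or.inr ⟨i, hi.2, rfl⟩)
        · exact Or.inl ⟨⟨hz, hzx⟩, hzP⟩
      subset := Set.sdiff_subset.trans Set.sdiff_subset
      mem := hx
      notMem := fun h => h.1.2 rfl
      notMem_path := fun i hi h => h.2 ⟨i, ⟨i.zero_le, hi⟩, rfl⟩
      ne := fun i hi e => hxP ⟨i, ⟨i.zero_le, hi⟩, e⟩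
      eq := by
        rw [union_singleton] at hlt
        have := hlt.trans_le (indepNumOn_insert_le _ _ _)
        omega
      lt_union := hlt }
  have hbound : ∀ m : ℕ, (m : ℕ∞) ≤ setConn G S → b + 2 + m ≤ indepNumOn G S := by
    intro m hm
    have hmy : ∀ y ∈ S₀, y ≠ x → m ≤ localConn G x y := fun y hy hyx => by
      have : setConn G S ≤ localConn G x y :=
        (iInf₂_le x (hS₀ hx)).trans ((iInf₂_le y (hS₀ hy)).trans (iInf_le _ hyx.symm))
      exact_mod_cast hm.trans this
    obtain ⟨C, E, h, hE, hC⟩ := exists_isFan ht.ne hmy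
    obtain ⟨h1, h2⟩ := ht.card_le_of_isFan hE
    have h3 := indepNumOn_mono (G := G) hS₀
    have : min m (S₀ ∩ v '' Ico 0 (n + 1)).ncard = m := by omega
    omega
  cases hk : setConn G S with
  | top =>
    have := hbound (indepNumOn G S) (hk ▸ le_top)
    omega
  | coe m =>
    have := hbound m hk.ge
    exact_mod_cast (by omega : b.succ + m + 2 ≤ indepNumOn G S + 1)

theorem exists_subgraph_indepNumOn_add_le [Finite V] (hG : G.Connected) (S : Set V) {k : ℕ}
    (hk : 2 ≤ k) :
    ∃ T : G.Subgraph, T.Connected ∧ T.spanningCoe.IsAcyclic ∧ (subLeaves T).ncard ≤ k ∧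
      (S ⊆ T.verts ∨
        (indepNumOn G (S \ T.verts) : ℕ∞) + setConn G S + k ≤ (indepNumOn G S : ℕ∞) + 1) := by
  induction k, hk using Nat.le_induction with
  | base =>
    have := hG.nonempty
    obtain ⟨u, w, F, p, h⟩ := exists_pathOn_indepNumOn_add_le G S
    obtain ⟨T, hc, ha, rfl, hl⟩ := p.exists_subgraph
    exact ⟨T, hc, ha, hl, h⟩
  | succ k hk ih =>
    obtain ⟨T, hc, ha, hl, hT⟩ := ih
    by_cases hS : S ⊆ T.verts
    · exact ⟨T, hc, ha, hl.trans k.le_succ, Or.inl hS⟩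
    obtain ⟨T', hc', ha', hl', hT'⟩ :=
      exists_subgraph_indepNumOn_add_one_le hG hk hc ha hl hS
    refine ⟨T', hc', ha', hl', Or.inr (le_trans ?_ (hT.resolve_left hS))⟩
    calc (indepNumOn G (S \ T'.verts) : ℕ∞) + setConn G S + (k + 1 : ℕ)
        = ((indepNumOn G (S \ T'.verts) + 1 : ℕ) : ℕ∞) + setConn G S + k := by push_cast; ring
      _ ≤ _ := by gcongr

end SimpleGraph

/-- Either `G` has a tree with at most `k` leaves covering `S`, or there is a tree `T`
with at most `k` leaves with `α_G(S - V(T)) ≤ α_G(S) - κ_G(S) - k + 1`. -/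
theorem stmt_1 [Fintype V] (G : SimpleGraph V) (hG : G.Connected)
    (k : ℕ) (hk : 2 ≤ k) (S : Set V) :
    (∃ T : G.Subgraph, T.coe.IsTree ∧ S ⊆ T.verts ∧ (subLeaves T).ncard ≤ k) ∨
    (∃ T : G.Subgraph, T.coe.IsTree ∧ (subLeaves T).ncard ≤ k ∧
      (indepNumOn G (S \ T.verts) : ℕ∞) + setConn G S + k ≤ (indepNumOn G S : ℕ∞) + 1) := by
  obtain ⟨T, hc, ha, hl, h | h⟩ := exists_subgraph_indepNumOn_add_le hG S hk
  · exact Or.inl ⟨T, isTree_coe_of_connected_of_isAcyclic hc ha, h, hl⟩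
  · exact Or.inr ⟨T, isTree_coe_of_connected_of_isAcyclic hc ha, hl, h⟩
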